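/- arXiv:2101.06496 — 3 statements merged into one kernel-verified Lean document; each statement's English description precedes it below -/
import Mathlib

section
/- Let K be a field, m ≤ n positive integers, X the m×n generic matrix over S = K[x_{ij}], and t an integer with 2 ≤ t ≤ m. For every width s with t ≤ s and every starting column a with 1 ≤ a and a + s ≤ n, one has I_t(X_{[a,a+s−1]}) + I_t(X_{[a+1,a+s]}) = I_t(X_{[a,a+s]}) ∩ I_{t−1}(X_{[a+1,a+s−1]}) as ideals of S. -/
/-- The ideal of `t × t` minors of the generic `m × n` matrix `X` (with entries
`X i j = MvPolynomial.X (i, j)`), using only rows with 1-based index in `[r1, r2]`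
and columns with 1-based index in `[c1, c2]`. -/
noncomputable def genMinors (K : Type*) [Field K] (m n : ℕ) (t : ℕ) (r1 r2 c1 c2 : ℕ) :
    Ideal (MvPolynomial (Fin m × Fin n) K) :=
  Ideal.span { p | ∃ (r : Fin t → Fin m) (c : Fin t → Fin n),
    StrictMono r ∧ StrictMono c ∧
    (∀ i, r1 ≤ (r i).val + 1 ∧ (r i).val + 1 ≤ r2) ∧
    (∀ j, c1 ≤ (c j).val + 1 ∧ (c j).val + 1 ≤ c2) ∧
    p = Matrix.det (Matrix.of fun i j => MvPolynomial.X (r i, c j)) }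

namespace SAM

/-- One local step of the (dual) growth rule. -/
def step (ρ μ ν c : ℕ) : ℕ × ℕ :=
  if μ = ρ ∧ ν = ρ then (if c = 0 then (ρ, 0) else (ρ + 1, c - 1))
  else (max μ ν, if μ ≠ ρ ∧ ν ≠ ρ then c + 1 else c)

def carry (ρ μ ν : ℕ → ℕ) (x : ℕ) : ℕ → ℕ
  | 0 => x
  | r + 1 => (step (ρ r) (μ r) (ν r) (carry ρ μ ν x r)).2

def nextRow (prev : ℕ → ℕ → ℕ) (x : ℕ → ℕ) : ℕ → ℕ → ℕ
  | 0 => fun _ => 0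
  | j + 1 => fun r => (step (prev j r) (prev (j + 1) r) (nextRow prev x j r)
      (carry (prev j) (prev (j + 1)) (nextRow prev x j) (x j) r)).1

def lam (M : ℕ → ℕ → ℕ) : ℕ → ℕ → ℕ → ℕ
  | 0 => fun _ _ => 0
  | i + 1 => nextRow (lam M i) (M i)

def car (M : ℕ → ℕ → ℕ) (i j : ℕ) : ℕ → ℕ :=
  carry (lam M i j) (lam M i (j + 1)) (lam M (i + 1) j) (M i j)

theorem lam_zero_left (M : ℕ → ℕ → ℕ) (j r : ℕ) : lam M 0 j r = 0 := rfl

theorem lam_zero_right (M : ℕ → ℕ → ℕ) (i r : ℕ) : lam M i 0 r = 0 := by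
  cases i <;> rfl

theorem lam_succ (M : ℕ → ℕ → ℕ) (i j r : ℕ) :
    lam M (i + 1) (j + 1) r =
      (step (lam M i j r) (lam M i (j + 1) r) (lam M (i + 1) j r) (car M i j r)).1 := rfl

theorem car_zero (M : ℕ → ℕ → ℕ) (i j : ℕ) : car M i j 0 = M i j := rfl

theorem car_succ (M : ℕ → ℕ → ℕ) (i j r : ℕ) :
    car M i j (r + 1) =
      (step (lam M i j r) (lam M i (j + 1) r) (lam M (i + 1) j r) (car M i j r)).2 := rfl

theorem step_spec (ρ μ ν c : ℕ) (h1 : ρ ≤ μ) (h2 : μ ≤ ρ + 1) (h3 : ρ ≤ ν) (h4 : ν ≤ ρ + 1) :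
    μ ≤ (step ρ μ ν c).1 ∧ (step ρ μ ν c).1 ≤ μ + 1 ∧
    ν ≤ (step ρ μ ν c).1 ∧ (step ρ μ ν c).1 ≤ ν + 1 ∧
    (step ρ μ ν c).1 + ρ + (step ρ μ ν c).2 = μ + ν + c := by
  unfold step
  split_ifs <;> simp only <;> omega

theorem lam_strip (M : ℕ → ℕ → ℕ) (i : ℕ) : (∀ j r, lam M i j r ≤ lam M i (j + 1) r ∧
    lam M i (j + 1) r ≤ lam M i j r + 1) ∧
    (∀ j r, lam M i j r ≤ lam M (i + 1) j r ∧ lam M (i + 1) j r ≤ lam M i j r + 1) := by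
  have key : ∀ i, (∀ j r, lam M i j r ≤ lam M i (j + 1) r ∧
      lam M i (j + 1) r ≤ lam M i j r + 1) →
      (∀ j r, lam M i j r ≤ lam M (i + 1) j r ∧ lam M (i + 1) j r ≤ lam M i j r + 1) := by
    intro i hi j
    induction j with
    | zero => intro r; simp [lam_zero_right]
    | succ j ih =>
      intro r
      rw [lam_succ]
      have := step_spec (lam M i j r) (lam M i (j + 1) r) (lam M (i + 1) j r) (car M i j r)
        (hi j r).1 (hi j r).2 (ih r).1 (ih r).2
      omega
  have h : ∀ i, (∀ j r, lam M i j r ≤ lam M i (j + 1) r ∧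
      lam M i (j + 1) r ≤ lam M i j r + 1) := by
    intro i
    induction i with
    | zero => intro j r; simp [lam_zero_left]
    | succ i ih =>
      intro j r
      rw [lam_succ]
      have := step_spec (lam M i j r) (lam M i (j + 1) r) (lam M (i + 1) j r) (car M i j r)
        (ih j r).1 (ih j r).2 (key i ih j r).1 (key i ih j r).2
      omega
  exact ⟨h i, key i (h i)⟩

theorem lam_spec (M : ℕ → ℕ → ℕ) (i j r : ℕ) :
    lam M (i + 1) (j + 1) r + lam M i j r + car M i j (r + 1) =
      lam M i (j + 1) r + lam M (i + 1) j r + car M i j r := by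
  rw [lam_succ, car_succ]
  exact (step_spec _ _ _ _ ((lam_strip M i).1 j r).1 ((lam_strip M i).1 j r).2
    ((lam_strip M i).2 j r).1 ((lam_strip M i).2 j r).2).2.2.2.2

theorem step_anti (ρ μ ν c ρ' μ' ν' : ℕ) (h1 : ρ ≤ μ) (h2 : μ ≤ ρ + 1) (h3 : ρ ≤ ν)
    (h4 : ν ≤ ρ + 1) (a1 : ρ' ≤ ρ) (a2 : μ' ≤ μ) (a3 : ν' ≤ ν) :
    (step ρ' μ' ν' (step ρ μ ν c).2).1 ≤ (step ρ μ ν c).1 := by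
  unfold step
  split_ifs <;> simp_all <;> omega

theorem lam_anti (M : ℕ → ℕ → ℕ) (i j r : ℕ) : lam M i j (r + 1) ≤ lam M i j r := by
  induction i generalizing j with
  | zero => simp [lam_zero_left]
  | succ i ih =>
    induction j with
    | zero => simp [lam_zero_right]
    | succ j ihj =>
      rw [lam_succ, lam_succ, car_succ]
      have A := lam_strip M i
      exact step_anti _ _ _ _ _ _ _ (A.1 j r).1 (A.1 j r).2 (A.2 j r).1 (A.2 j r).2
        (ih j) (ih (j+1)) ihj

theorem lam_antitone (M : ℕ → ℕ → ℕ) (i j : ℕ) : Antitone (lam M i j) :=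
  antitone_nat_of_succ_le (lam_anti M i j)

theorem lam_mono_right (M : ℕ → ℕ → ℕ) (i r : ℕ) : Monotone (fun j => lam M i j r) :=
  monotone_nat_of_le_succ fun j => ((lam_strip M i).1 j r).1

theorem lam_mono_left (M : ℕ → ℕ → ℕ) (j r : ℕ) : Monotone (fun i => lam M i j r) :=
  monotone_nat_of_le_succ fun i => ((lam_strip M i).2 j r).1

/-- size bound -/
theorem lam_size (M : ℕ → ℕ → ℕ) (R i j : ℕ) :
    ∑ r ∈ Finset.range R, lam M i j r + ∑ i' ∈ Finset.range i, ∑ j' ∈ Finset.range j, car M i' j' R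
      = ∑ i' ∈ Finset.range i, ∑ j' ∈ Finset.range j, M i' j' := by
  have cell : ∀ i j, ∑ r ∈ Finset.range R, lam M (i + 1) (j + 1) r
      + ∑ r ∈ Finset.range R, lam M i j r + car M i j R =
      ∑ r ∈ Finset.range R, lam M i (j + 1) r + ∑ r ∈ Finset.range R, lam M (i + 1) j r
        + M i j := by
    intro i j
    induction R with
    | zero => simp [car_zero]
    | succ R ih =>
      simp only [Finset.sum_range_succ]
      have := lam_spec M i j R
      omega
  induction i generalizing j with
  | zero => simp [lam_zero_left]
  | succ i ih =>
    induction j with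
    | zero => simp [lam_zero_right]
    | succ j ihj =>
      have h1 := ih j
      have h2 := ih (j + 1)
      have h3 := cell i j
      have s1 : ∀ (F : ℕ → ℕ → ℕ) (j : ℕ), ∑ i' ∈ Finset.range (i + 1), ∑ j' ∈ Finset.range j, F i' j'
          = ∑ i' ∈ Finset.range i, ∑ j' ∈ Finset.range j, F i' j' + ∑ j' ∈ Finset.range j, F i j' :=
        fun F j => Finset.sum_range_succ _ _
      have s2 : ∀ (F : ℕ → ℕ), ∑ j' ∈ Finset.range (j + 1), F j' = ∑ j' ∈ Finset.range j, F j' + F j :=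
        fun F => Finset.sum_range_succ _ _
      rw [s1 (fun i' j' => car M i' j' R), s1] at ihj ⊢
      rw [s2 (fun j' => car M i j' R), s2 (M i)]
      omega

theorem lam_sum_le (M : ℕ → ℕ → ℕ) (R i j d : ℕ)
    (hd : ∑ i' ∈ Finset.range i, ∑ j' ∈ Finset.range j, M i' j' ≤ d) :
    ∑ r ∈ Finset.range R, lam M i j r ≤ d := by
  have := lam_size M R i j
  omega

theorem lam_eq_zero (M : ℕ → ℕ → ℕ) (i j d : ℕ)
    (hd : ∑ i' ∈ Finset.range i, ∑ j' ∈ Finset.range j, M i' j' ≤ d) (r : ℕ) (hr : d ≤ r) :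
    lam M i j r = 0 := by
  by_contra h
  have h1 := lam_sum_le M (r + 1) i j d hd
  have h2 : ∑ _r' ∈ Finset.range (r + 1), 1 ≤ ∑ r' ∈ Finset.range (r + 1), lam M i j r' := by
    apply Finset.sum_le_sum
    intro r' hr'
    have := lam_antitone M i j (show r' ≤ r by simp at hr'; omega)
    omega
  simp at h2
  omega

theorem step_inj (ρ ρ' μ ν c c' : ℕ) (h1 : ρ ≤ μ) (h2 : μ ≤ ρ + 1) (h3 : ρ ≤ ν)
    (h4 : ν ≤ ρ + 1) (h1' : ρ' ≤ μ) (h2' : μ ≤ ρ' + 1) (h3' : ρ' ≤ ν) (h4' : ν ≤ ρ' + 1)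
    (e1 : (step ρ μ ν c).1 = (step ρ' μ ν c').1) (e2 : (step ρ μ ν c).2 = (step ρ' μ ν c').2) :
    ρ = ρ' ∧ c = c' := by
  unfold step at e1 e2
  split_ifs at e1 e2 <;> simp_all <;> omega

theorem car_eq_zero (M : ℕ → ℕ → ℕ) (i j r : ℕ) (h : lam M (i + 1) (j + 1) r = 0) :
    car M i j r = 0 := by
  have A := lam_strip M i
  have B := lam_strip M (i + 1)
  have h1 : lam M (i + 1) j r = 0 := by have := (B.1 j r).1; omega
  have h2 : lam M i (j + 1) r = 0 := by have := (A.2 (j + 1) r).1; omega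
  have h3 : lam M i j r = 0 := by have := (A.2 j r).1; omega
  rw [lam_succ, h1, h2, h3] at h
  unfold step at h
  by_contra hc
  simp [hc] at h

theorem cell_inj (M M' : ℕ → ℕ → ℕ) (i j R : ℕ)
    (e1 : lam M (i + 1) (j + 1) = lam M' (i + 1) (j + 1))
    (e2 : lam M i (j + 1) = lam M' i (j + 1)) (e3 : lam M (i + 1) j = lam M' (i + 1) j)
    (hR : ∀ r, R ≤ r → lam M (i + 1) (j + 1) r = 0) :
    lam M i j = lam M' i j ∧ M i j = M' i j := by
  have hc0 : ∀ r, R ≤ r → car M i j r = car M' i j r := by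
    intro r hr
    rw [car_eq_zero M i j r (hR r hr), car_eq_zero M' i j r (by rw [← e1]; exact hR r hr)]
  have A := lam_strip M i
  have A' := lam_strip M' i
  have st : ∀ r, car M i j (r + 1) = car M' i j (r + 1) →
      lam M i j r = lam M' i j r ∧ car M i j r = car M' i j r := by
    intro r hr
    have a1 := A'.1 j r
    have a2 := A'.2 j r
    have f1 := congrFun e1 r
    rw [← congrFun e2 r] at a1
    rw [← congrFun e3 r] at a2
    rw [lam_succ, lam_succ, ← congrFun e2 r, ← congrFun e3 r] at f1
    rw [car_succ, car_succ, ← congrFun e2 r, ← congrFun e3 r] at hr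
    exact step_inj _ _ _ _ _ _ (A.1 j r).1 (A.1 j r).2 (A.2 j r).1 (A.2 j r).2
      a1.1 a1.2 a2.1 a2.2 f1 hr
  have hc : ∀ r, car M i j r = car M' i j r := by
    intro r
    by_cases hr : R ≤ r
    · exact hc0 r hr
    · have : ∀ k, k ≤ R → car M i j (R - k) = car M' i j (R - k) := by
        intro k
        induction k with
        | zero => intro _; exact hc0 _ le_rfl
        | succ k ih =>
          intro hk
          apply (st _ _).2
          have : R - (k + 1) + 1 = R - k := by omega
          rw [this]
          exact ih (by omega)
      have h2 := this (R - r) (by omega)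
      have h3 : R - (R - r) = r := by omega
      rwa [h3] at h2
  exact ⟨funext fun r => (st r (hc _)).1, hc 0⟩

theorem lam_inj (M M' : ℕ → ℕ → ℕ) (m n R : ℕ)
    (e1 : ∀ i ≤ m, lam M i n = lam M' i n) (e2 : ∀ j ≤ n, lam M m j = lam M' m j)
    (hR : ∀ r, R ≤ r → lam M m n r = 0) :
    ∀ i < m, ∀ j < n, M i j = M' i j := by
  have hR' : ∀ i ≤ m, ∀ j ≤ n, ∀ r, R ≤ r → lam M i j r = 0 := by
    intro i hi j hj r hr
    have h1 := lam_mono_left M j r hi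
    have h2 := lam_mono_right M m r hj
    have := hR r hr
    simp only at h1 h2
    omega
  have key : ∀ k ≤ m, ∀ l ≤ n, lam M (m - k) (n - l) = lam M' (m - k) (n - l) := by
    intro k
    induction k with
    | zero => intro _ l _; simpa using e2 _ (Nat.sub_le n l)
    | succ k ih =>
      intro hk l
      induction l with
      | zero => intro _; simpa using e1 _ (Nat.sub_le m _)
      | succ l ihl =>
        intro hl
        have a1 : m - (k + 1) + 1 = m - k := by omega
        have a2 : n - (l + 1) + 1 = n - l := by omega
        refine (cell_inj M M' (m - (k + 1)) (n - (l + 1)) R ?_ ?_ ?_ ?_).1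
        · rw [a1, a2]; exact ih (by omega) l (by omega)
        · rw [a2]; exact ihl (by omega)
        · rw [a1]; exact ih (by omega) (l + 1) hl
        · rw [a1, a2]; exact hR' _ (by omega) _ (by omega)
  have key' : ∀ i ≤ m, ∀ j ≤ n, lam M i j = lam M' i j := by
    intro i hi j hj
    have := key (m - i) (by omega) (n - j) (by omega)
    rwa [show m - (m - i) = i by omega, show n - (n - j) = j by omega] at this
  intro i hi j hj
  exact (cell_inj M M' i j R (key' _ hi _ hj) (key' _ hi.le _ hj) (key' _ hi _ hj.le)
    (hR' _ hi _ hj)).2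

/-- A zero column does not change the partition. -/
theorem lam_zero_col (M : ℕ → ℕ → ℕ) (j : ℕ) (hj : ∀ i, M i j = 0) (i r : ℕ) :
    lam M i (j + 1) r = lam M i j r := by
  induction i generalizing r with
  | zero => simp [lam_zero_left]
  | succ i ih =>
    have hc : ∀ r, car M i j r = 0 := by
      intro r
      induction r with
      | zero => rw [car_zero, hj]
      | succ r ihr => 
        rw [car_succ, ihr, ih]
        unfold step; split_ifs <;> simp_all
    have := ((lam_strip M i).2 j r).1
    rw [lam_succ, hc, ih]
    unfold step
    split_ifs <;> simp_all

/-- `M` has a strict chain of length `k` in the box `[0,i) × [0,j)`. -/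
theorem lam_chain (M : ℕ → ℕ → ℕ) (i j k : ℕ) (hk : k ≤ lam M i j 0) :
    ∃ a b : ℕ → ℕ, (∀ l, l < k → a l < i ∧ b l < j ∧ M (a l) (b l) ≠ 0) ∧
      (∀ l l', l < l' → l' < k → a l < a l' ∧ b l < b l') := by
  induction i generalizing j k with
  | zero => exact ⟨id, id, by simp [lam_zero_left] at hk; simp [hk]⟩
  | succ i ih =>
    induction j generalizing k with
    | zero => exact ⟨id, id, by simp [lam_zero_right] at hk; simp [hk]⟩
    | succ j ihj =>
      by_cases h1 : k ≤ lam M i (j + 1) 0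
      · obtain ⟨a, b, h, h'⟩ := ih _ _ h1
        exact ⟨a, b, fun l hl => ⟨by have := h l hl; omega, (h l hl).2⟩, h'⟩
      by_cases h2 : k ≤ lam M (i + 1) j 0
      · obtain ⟨a, b, h, h'⟩ := ihj _ h2
        exact ⟨a, b, fun l hl => ⟨(h l hl).1, by have := h l hl; omega, (h l hl).2.2⟩, h'⟩
      have hx : M i j ≠ 0 ∧ k = lam M i j 0 + 1 := by
        rw [lam_succ, car_zero] at hk
        have A1 := (lam_strip M i).1 j 0
        have A2 := (lam_strip M i).2 j 0
        unfold step at hk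
        split_ifs at hk <;> simp at hk <;> omega
      obtain ⟨a, b, h, h'⟩ := ih j (lam M i j 0) le_rfl
      refine ⟨fun l => if l < lam M i j 0 then a l else i,
        fun l => if l < lam M i j 0 then b l else j, ?_, ?_⟩
      · intro l hl
        by_cases hl' : l < lam M i j 0
        · simp only [hl', if_true]; have := h l hl'; exact ⟨by omega, by omega, this.2.2⟩
        · simp only [hl', if_false]; exact ⟨by omega, by omega, hx.1⟩
      · intro l l' hll hl'
        have : l < lam M i j 0 := by omega
        simp only [this, if_true]
        by_cases hl2 : l' < lam M i j 0
        · simp only [hl2, if_true]; exact h' _ _ hll hl2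
        · simp only [hl2, if_false]; have := h l this; omega

/-- unit step functions -/
theorem exists_jump (g : ℕ → ℕ) (h0 : g 0 = 0) (hs : ∀ i, g i ≤ g (i + 1) ∧ g (i + 1) ≤ g i + 1)
    (N k : ℕ) (hk : k < g N) : ∃ i, i < N ∧ g i = k ∧ g (i + 1) = k + 1 := by
  induction N with
  | zero => omega
  | succ N ih =>
    by_cases h : k < g N
    · obtain ⟨i, hi, h⟩ := ih h
      exact ⟨i, by omega, h⟩
    · have := hs N
      exact ⟨N, by omega, by omega, by omega⟩

end SAM

namespace SAM

open MvPolynomial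

/-- degree-lexicographic order attached to an injective key -/
noncomputable def mord {σ : Type} [Finite σ] (key : σ → ℕ ×ₗ ℕ ×ₗ ℕ)
    (hk : Function.Injective key) : MonomialOrder σ :=
  let _ : LinearOrder σ := LinearOrder.lift' key hk
  MonomialOrder.degLex

open scoped MonomialOrder

theorem mord_totalDegree {σ : Type} [Finite σ] (key : σ → ℕ ×ₗ ℕ ×ₗ ℕ)
    (hk : Function.Injective key) {R : Type*} [CommSemiring R] (f g : MvPolynomial σ R)
    (h : (mord key hk).degree f ≼[mord key hk] (mord key hk).degree g) :
    f.totalDegree ≤ g.totalDegree := by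
  let _ : LinearOrder σ := LinearOrder.lift' key hk
  exact degLex_totalDegree_monotone h

theorem mord_lt {σ : Type} [Finite σ] (key : σ → ℕ ×ₗ ℕ ×ₗ ℕ)
    (hk : Function.Injective key) {ι : Type} [Fintype ι] (u v : ι → σ) (k0 : ι)
    (h0 : key (u k0) < key (v k0))
    (h : ∀ k, k ≠ k0 → u k = v k ∨ (key (u k0) < key (u k) ∧ key (u k0) < key (v k))) :
    (∑ k, Finsupp.single (v k) 1) ≺[mord key hk] (∑ k, Finsupp.single (u k) 1) := by
  classical
  let _ : LinearOrder σ := LinearOrder.lift' key hk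
  have hlt : ∀ x y : σ, x < y ↔ key x < key y := fun x y => Iff.rfl
  change (∑ k, Finsupp.single (v k) 1) ≺[MonomialOrder.degLex] (∑ k, Finsupp.single (u k) 1)
  rw [MonomialOrder.degLex_lt_iff, Finsupp.DegLex.lt_iff]
  right
  constructor
  · simp [ofDegLex_toDegLex, map_sum]
  · refine ⟨u k0, ?_, ?_⟩
    · intro x hx
      change (∑ k, Finsupp.single (v k) 1 : σ →₀ ℕ) x = (∑ k, Finsupp.single (u k) 1 : σ →₀ ℕ) x
      rw [Finsupp.finsetSum_apply, Finsupp.finsetSum_apply]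
      apply Finset.sum_congr rfl
      intro k _
      rw [hlt] at hx
      have ne : ∀ y, key (u k0) < key y → (Finsupp.single y 1 : σ →₀ ℕ) x = 0 := by
        intro y hy
        apply Finsupp.single_eq_of_ne
        rintro rfl
        exact lt_asymm hx hy
      by_cases hkk : k = k0
      · subst hkk
        rw [ne _ h0, Finsupp.single_eq_of_ne]
        rintro rfl
        exact lt_irrefl _ hx
      · rcases h k hkk with h | h
        · rw [h]
        · rw [ne _ h.1, ne _ h.2]
    · change (∑ k, Finsupp.single (v k) 1 : σ →₀ ℕ) (u k0)
        < (∑ k, Finsupp.single (u k) 1 : σ →₀ ℕ) (u k0)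
      rw [Finsupp.finsetSum_apply, Finsupp.finsetSum_apply]
      have ne : ∀ y, key (u k0) < key y → (Finsupp.single y 1 : σ →₀ ℕ) (u k0) = 0 := by
        intro y hy
        apply Finsupp.single_eq_of_ne
        rintro rfl
        exact lt_irrefl _ hy
      apply Finset.sum_lt_sum
      · intro k _
        by_cases hkk : k = k0
        · subst hkk
          rw [ne _ h0]; exact Nat.zero_le _
        · rcases h k hkk with h | h
          · rw [h]
          · rw [ne _ h.2]; exact Nat.zero_le _
      · refine ⟨k0, Finset.mem_univ _, ?_⟩
        rw [ne _ h0]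
        simp

/-- Leading term of a sum of signed monomials with a dominating one. -/
theorem lead_sum {σ : Type} (mo : MonomialOrder σ) {R : Type*} [CommRing R] [Nontrivial R]
    {T : Type} (s : Finset T) (c : T → R) (e : T → (σ →₀ ℕ)) (t0 : T) (h0 : t0 ∈ s)
    (hc : c t0 = 1) (h : ∀ t ∈ s, t ≠ t0 → e t ≺[mo] e t0) :
    mo.degree (∑ t ∈ s, monomial (e t) (c t)) = e t0 ∧
    mo.leadingCoeff (∑ t ∈ s, monomial (e t) (c t)) = 1 := by
  classical
  have hcoef : coeff (e t0) (∑ t ∈ s, monomial (e t) (c t)) = 1 := by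
    rw [coeff_sum, Finset.sum_eq_single t0]
    · simp [hc]
    · intro t ht hne
      rw [coeff_monomial, if_neg]
      intro heq
      have := h t ht hne
      rw [heq] at this
      exact lt_irrefl _ this
    · intro h; exact absurd h0 h
  have hd : mo.degree (∑ t ∈ s, monomial (e t) (c t)) = e t0 := by
    apply mo.toSyn.injective
    apply le_antisymm
    · rw [MonomialOrder.degree_le_iff]
      intro b hb
      rw [mem_support_iff, coeff_sum] at hb
      obtain ⟨t, ht, hne⟩ := Finset.exists_ne_zero_of_sum_ne_zero hb
      rw [coeff_monomial] at hne
      have : e t = b := by by_contra hh; simp [hh] at hne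
      rw [← this]
      by_cases htt : t = t0
      · rw [htt]
      · exact (h t ht htt).le
    · apply MonomialOrder.le_degree
      rw [mem_support_iff, hcoef]
      exact one_ne_zero
  refine ⟨hd, ?_⟩
  rw [MonomialOrder.leadingCoeff, hd, hcoef]

theorem prod_X_eq {σ : Type} {R : Type*} [CommSemiring R] {ι : Type} (s : Finset ι) (u : ι → σ) :
    (∏ k ∈ s, X (u k) : MvPolynomial σ R) = monomial (∑ k ∈ s, Finsupp.single (u k) 1) 1 := by
  rw [monomial_sum_one]; rfl

theorem sign_smul_monomial {σ : Type} {R : Type*} [CommRing R] (s : ℤˣ) (e : σ →₀ ℕ) :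
    s • (monomial e (1 : R)) = monomial e (((s : ℤ) : R)) := by
  rcases Int.units_eq_one_or s with rfl | rfl <;> simp

theorem klt1 (a b c a' b' c' : ℕ) : (toLex (a, toLex (b, c)) : ℕ ×ₗ ℕ ×ₗ ℕ) < toLex (a', toLex (b', c')) ↔
    a < a' ∨ a = a' ∧ (b < b' ∨ b = b' ∧ c < c') := by
  simp [Prod.Lex.toLex_lt_toLex]

/-- first non-fixed point of an injective map that is not the identity -/
theorem first_diff {p : ℕ} (l : Fin p → ℕ) (hl : Function.Injective l) (hne : ∃ k, l k ≠ k) :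
    ∃ k0 : Fin p, (∀ k, k < k0 → l k = k) ∧ (k0 : ℕ) < l k0 := by
  classical
  obtain ⟨k0, hk0, hmin⟩ := WellFounded.has_min (wellFounded_lt (α := Fin p))
    {k | l k ≠ k} hne
  have h1 : ∀ k, k < k0 → l k = k := by
    intro k hk
    by_contra hh
    exact hmin k hh hk
  refine ⟨k0, h1, ?_⟩
  by_contra hlt
  have h2 : l k0 < k0 := lt_of_le_of_ne (not_lt.mp hlt) hk0
  have h3 := h1 ⟨l k0, h2.trans k0.2⟩ h2
  have := hl h3
  rw [Fin.ext_iff] at this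
  simp only at this
  omega

/-- key on the generic matrix -/
def keyX (m n : ℕ) : Fin m × Fin n → ℕ ×ₗ ℕ ×ₗ ℕ := fun x => toLex (0, toLex (x.1.val, x.2.val))

theorem keyX_inj (m n : ℕ) : Function.Injective (keyX m n) := by
  rintro ⟨i, j⟩ ⟨i', j'⟩ h
  have h1 : ((0 : ℕ), (toLex (i.val, j.val) : ℕ ×ₗ ℕ)) = (0, toLex (i'.val, j'.val)) := h
  have h2 : ((i.val, j.val) : ℕ × ℕ) = (i'.val, j'.val) := (Prod.mk.inj h1).2
  simp only [Prod.mk.injEq] at h2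
  simp [Fin.ext_iff, h2]

noncomputable abbrev moX (m n : ℕ) : MonomialOrder (Fin m × Fin n) := mord (keyX m n) (keyX_inj m n)

theorem lead_minor {m n t : ℕ} (K : Type*) [Field K] (r : Fin t → Fin m) (c : Fin t → Fin n)
    (hr : StrictMono r) (hc : StrictMono c) :
    (moX m n).degree (Matrix.det (Matrix.of fun i j => (X (r i, c j) : MvPolynomial _ K)))
      = ∑ k, Finsupp.single (r k, c k) 1 ∧
    (moX m n).leadingCoeff (Matrix.det (Matrix.of fun i j => (X (r i, c j) : MvPolynomial _ K)))
      = 1 := by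
  have hdet : Matrix.det (Matrix.of fun i j => (X (r i, c j) : MvPolynomial _ K)) =
      ∑ τ : Equiv.Perm (Fin t), monomial (∑ k, Finsupp.single (r k, c (τ k)) 1)
        (((Equiv.Perm.sign τ : ℤˣ) : ℤ) : K) := by
    rw [← Matrix.det_transpose, Matrix.det_apply]
    apply Finset.sum_congr rfl
    intro τ _
    rw [← sign_smul_monomial, ← prod_X_eq]
    rfl
  rw [hdet]
  have := lead_sum (moX m n) Finset.univ
    (fun τ : Equiv.Perm (Fin t) => (((Equiv.Perm.sign τ : ℤˣ) : ℤ) : K))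
    (fun τ => ∑ k, Finsupp.single (r k, c (τ k)) 1) 1 (Finset.mem_univ _) (by simp) ?_
  · simpa using this
  · intro τ _ hne
    obtain ⟨k0, h1, h2⟩ := first_diff (fun k => (τ k : ℕ))
      (fun a b h => τ.injective (Fin.ext h)) (by
        by_contra hh
        push Not at hh
        exact hne (Equiv.ext fun k => Fin.ext (hh k)))
    apply mord_lt (keyX m n) (keyX_inj m n) (fun k => (r k, c k)) (fun k => (r k, c (τ k))) k0
    · simp only [keyX]
      rw [klt1]
      right
      exact ⟨rfl, Or.inr ⟨rfl, hc h2⟩⟩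
    · intro k hk
      rcases lt_or_gt_of_ne hk with h | h
      · left
        have : τ k = k := Fin.ext (h1 k h)
        simp [this]
      · right
        simp only [keyX]
        rw [klt1, klt1]
        exact ⟨Or.inr ⟨rfl, Or.inl (hr h)⟩, Or.inr ⟨rfl, Or.inl (hr h)⟩⟩

end SAM

namespace SAM

open MvPolynomial
open scoped MonomialOrder

theorem det_expand {R : Type*} [CommRing R] {p q : ℕ} (A : Fin p → Fin q → R) (B : Fin q → Fin p → R) :
    Matrix.det (Matrix.of fun x y => ∑ l, A x l * B l y) =
      ∑ l : Fin p → Fin q, (∏ x, A x (l x)) * Matrix.det (Matrix.of fun x y => B (l x) y) := by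
  classical
  have h1 : ∀ N : Matrix (Fin p) (Fin p) R, N.det =
      ∑ τ : Equiv.Perm (Fin p), ((Equiv.Perm.sign τ : ℤ) : R) * ∏ x, N x (τ x) := by
    intro N
    rw [← Matrix.det_transpose, Matrix.det_apply']
    rfl
  rw [h1]
  simp_rw [h1]
  simp only [Matrix.of_apply]
  have h2 : ∀ τ : Equiv.Perm (Fin p), ∏ x, ∑ l, A x l * B l (τ x) =
      ∑ l : Fin p → Fin q, ∏ x, A x (l x) * B (l x) (τ x) := by
    intro τ
    rw [Finset.prod_univ_sum, Fintype.piFinset_univ]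
  simp_rw [h2, Finset.mul_sum]
  rw [Finset.sum_comm]
  apply Finset.sum_congr rfl
  intro l _
  apply Finset.sum_congr rfl
  intro τ _
  rw [Finset.prod_mul_distrib]
  ring

theorem det_expand_inj {R : Type*} [CommRing R] {p q : ℕ} (A : Fin p → Fin q → R)
    (B : Fin q → Fin p → R) :
    Matrix.det (Matrix.of fun x y => ∑ l, A x l * B l y) =
      ∑ l : Fin p → Fin q with Function.Injective l,
        (∏ x, A x (l x)) * Matrix.det (Matrix.of fun x y => B (l x) y) := by
  classical
  rw [det_expand, Finset.sum_filter_of_ne]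
  intro l _ hl
  by_contra hni
  apply hl
  rw [Function.Injective] at hni
  push Not at hni
  obtain ⟨x, y, hxy, hne⟩ := hni
  rw [Matrix.det_zero_of_row_eq hne, mul_zero]
  funext z
  simp [hxy]

theorem det_lt_zero {R : Type*} [CommRing R] {p q : ℕ} (h : q < p) (A : Fin p → Fin q → R)
    (B : Fin q → Fin p → R) :
    Matrix.det (Matrix.of fun x y => ∑ l, A x l * B l y) = 0 := by
  classical
  rw [det_expand_inj]
  apply Finset.sum_eq_zero
  intro l hl
  have := Fintype.card_le_of_injective l (Finset.mem_filter.mp hl).2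
  simp at this
  omega

abbrev Vars (q m n : ℕ) : Type := (Fin m × Fin q) ⊕ ((Fin q × Fin n) ⊕ (Fin m × Fin n))

def keyY (q m n : ℕ) : Vars q m n → ℕ ×ₗ ℕ ×ₗ ℕ
  | Sum.inl x => toLex (0, toLex (x.1.val, x.2.val))
  | Sum.inr (Sum.inl x) => toLex (1, toLex (x.1.val, x.2.val))
  | Sum.inr (Sum.inr x) => toLex (2, toLex (x.1.val, x.2.val))

theorem key_eq (a b c a' b' c' : ℕ) (h : (toLex (a, toLex (b, c)) : ℕ ×ₗ ℕ ×ₗ ℕ) = toLex (a', toLex (b', c'))) :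
    a = a' ∧ b = b' ∧ c = c' := by
  have h1 : (a, (toLex (b, c) : ℕ ×ₗ ℕ)) = (a', toLex (b', c')) := h
  have h2 : ((b, c) : ℕ × ℕ) = (b', c') := (Prod.mk.inj h1).2
  exact ⟨(Prod.mk.inj h1).1, by simpa using h2⟩

theorem keyY_inj (q m n : ℕ) : Function.Injective (keyY q m n) := by
  rintro (⟨i, j⟩ | ⟨i, j⟩ | ⟨i, j⟩) (⟨i', j'⟩ | ⟨i', j'⟩ | ⟨i', j'⟩) h <;>
    simp only [keyY] at h <;> have := key_eq _ _ _ _ _ _ h <;> simp [Fin.ext_iff] at this ⊢ <;> exact this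

noncomputable abbrev moY (q m n : ℕ) : MonomialOrder (Vars q m n) := mord (keyY q m n) (keyY_inj q m n)

noncomputable def ab (K : Type*) [Field K] (q m n : ℕ) (i : Fin m) (j : Fin n) :
    MvPolynomial (Vars q m n) K :=
  ∑ l : Fin q, X (Sum.inl (i, l)) * X (Sum.inr (Sum.inl (l, j)))

theorem lead_ab {q m n p : ℕ} (K : Type*) [Field K] (hpq : p ≤ q) (r : Fin p → Fin m)
    (c : Fin p → Fin n) (hr : StrictMono r) (hc : StrictMono c) :
    (moY q m n).degree (Matrix.det (Matrix.of fun i j => ab K q m n (r i) (c j)))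
      = ∑ k, (Finsupp.single (Sum.inl (r k, Fin.castLE hpq k)) 1 +
          Finsupp.single (Sum.inr (Sum.inl (Fin.castLE hpq k, c k))) 1) ∧
    (moY q m n).leadingCoeff (Matrix.det (Matrix.of fun i j => ab K q m n (r i) (c j))) = 1 := by
  classical
  let w : (Fin p → Fin q) × Equiv.Perm (Fin p) → Fin p ⊕ Fin p → Vars q m n := fun lt =>
    Sum.elim (fun k => Sum.inl (r k, lt.1 k)) (fun k => Sum.inr (Sum.inl (lt.1 k, c (lt.2 k))))
  have hdet : Matrix.det (Matrix.of fun i j => ab K q m n (r i) (c j)) =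
      ∑ lt ∈ (Finset.univ.filter fun l : Fin p → Fin q => Function.Injective l) ×ˢ
        (Finset.univ : Finset (Equiv.Perm (Fin p))),
        monomial (∑ k, Finsupp.single (w lt k) 1) (((Equiv.Perm.sign lt.2 : ℤˣ) : ℤ) : K) := by
    unfold ab
    rw [det_expand_inj (fun x l => X (Sum.inl (r x, l)))
      (fun l y => X (Sum.inr (Sum.inl (l, c y)))), Finset.sum_product]
    apply Finset.sum_congr rfl
    intro l _
    rw [← Matrix.det_transpose, Matrix.det_apply, Finset.mul_sum]
    apply Finset.sum_congr rfl
    intro τ _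
    rw [← sign_smul_monomial, ← prod_X_eq, Fintype.prod_sum_type, mul_smul_comm]
    rfl
  rw [hdet]
  have := lead_sum (moY q m n)
    (fun lt : (Fin p → Fin q) × Equiv.Perm (Fin p) => (((Equiv.Perm.sign lt.2 : ℤˣ) : ℤ) : K))
    (fun lt => ∑ k, Finsupp.single (w lt k) 1) (Fin.castLE hpq, 1)
    (s := (Finset.univ.filter fun l : Fin p → Fin q => Function.Injective l) ×ˢ
        (Finset.univ : Finset (Equiv.Perm (Fin p))))
    (by simp [Fin.castLE_injective]) (by simp) ?_
  · refine ⟨this.1.trans ?_, this.2⟩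
    rw [Fintype.sum_sum_type, Finset.sum_add_distrib]
    rfl
  · rintro ⟨l, τ⟩ hmem hne
    have hl : Function.Injective l := by simpa using hmem
    by_cases hlid : ∃ k, ((l k : Fin q) : ℕ) ≠ k
    · obtain ⟨k0, h1, h2⟩ := first_diff (fun k => (l k : ℕ))
        (fun a b h => hl (Fin.ext h)) hlid
      apply mord_lt (keyY q m n) (keyY_inj q m n) (w (Fin.castLE hpq, 1)) (w (l, τ)) (Sum.inl k0)
      · simp only [w, Sum.elim_inl, keyY]
        rw [klt1]
        exact Or.inr ⟨rfl, Or.inr ⟨rfl, h2⟩⟩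
      · rintro (k | k) hk
        · have hk' : k ≠ k0 := fun h => hk (by rw [h])
          rcases lt_or_gt_of_ne hk' with h | h
          · left
            have : l k = Fin.castLE hpq k := Fin.ext (h1 k h)
            simp [w, this]
          · right
            simp only [w, Sum.elim_inl, keyY]
            rw [klt1, klt1]
            exact ⟨Or.inr ⟨rfl, Or.inl (hr h)⟩, Or.inr ⟨rfl, Or.inl (hr h)⟩⟩
        · right
          simp only [w, Sum.elim_inl, Sum.elim_inr, keyY]
          rw [klt1, klt1]
          exact ⟨Or.inl one_pos, Or.inl one_pos⟩
    · push Not at hlid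
      have hl' : l = Fin.castLE hpq := funext fun k => Fin.ext (hlid k)
      subst hl'
      have hτ : τ ≠ 1 := fun h => hne (by rw [h])
      obtain ⟨k0, h1, h2⟩ := first_diff (fun k => (τ k : ℕ))
        (fun a b h => τ.injective (Fin.ext h)) (by
          by_contra hh
          push Not at hh
          exact hτ (Equiv.ext fun k => Fin.ext (hh k)))
      apply mord_lt (keyY q m n) (keyY_inj q m n) (w (Fin.castLE hpq, 1))
        (w (Fin.castLE hpq, τ)) (Sum.inr k0)
      · simp only [w, Sum.elim_inr, keyY]
        rw [klt1]
        exact Or.inr ⟨rfl, Or.inr ⟨rfl, hc h2⟩⟩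
      · rintro (k | k) hk
        · left
          rfl
        · have hk' : k ≠ k0 := fun h => hk (by rw [h])
          rcases lt_or_gt_of_ne hk' with h | h
          · left
            have : τ k = k := Fin.ext (h1 k h)
            simp [w, this]
          · right
            simp only [w, Sum.elim_inr, keyY]
            rw [klt1, klt1]
            exact ⟨Or.inr ⟨rfl, Or.inl h⟩, Or.inr ⟨rfl, Or.inl h⟩⟩

end SAM

namespace SAM

open MvPolynomial
open scoped MonomialOrder

theorem linInd_of_degree {σ : Type} (mo : MonomialOrder σ) {K : Type*} [Field K] {ι : Type}
    (g : ι → MvPolynomial σ K) (h0 : ∀ i, g i ≠ 0)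
    (hinj : Function.Injective fun i => mo.degree (g i)) : LinearIndependent K g := by
  classical
  rw [linearIndependent_iff']
  intro s c hs
  by_contra hne
  push Not at hne
  obtain ⟨i1, hi1, hc1⟩ := hne
  obtain ⟨i0, hi0, hmax⟩ := Finset.exists_max_image (s.filter fun i => c i ≠ 0)
    (fun i => mo.toSyn (mo.degree (g i))) ⟨i1, by simp [hi1, hc1]⟩
  rw [Finset.mem_filter] at hi0
  have hco := congrArg (coeff (mo.degree (g i0))) hs
  rw [coeff_sum, coeff_zero, Finset.sum_eq_single i0] at hco
  · rw [coeff_smul, smul_eq_mul] at hco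
    rcases mul_eq_zero.mp hco with h | h
    · exact hi0.2 h
    · exact h0 i0 ((mo.coeff_degree_eq_zero_iff).mp h)
  · intro i hi hii
    rw [coeff_smul, smul_eq_mul]
    by_cases hci : c i = 0
    · rw [hci, zero_mul]
    · rw [mo.coeff_eq_zero_of_lt, mul_zero]
      apply lt_of_le_of_ne (hmax i (by simp [hi, hci]))
      intro h
      exact hii (hinj (mo.toSyn.injective h))
  · intro h
    exact absurd hi0.1 h

theorem count_lt (P : ℕ → Prop) [DecidablePred P] (hP : ∀ r r', r ≤ r' → P r' → P r) (D r : ℕ)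
    (hr : r < D) : P r ↔ r < ((Finset.range D).filter P).card := by
  constructor
  · intro h
    have : Finset.range (r + 1) ⊆ (Finset.range D).filter P := by
      intro x hx
      simp at hx ⊢
      exact ⟨by omega, hP _ _ (by omega) h⟩
    have := Finset.card_le_card this
    simp at this
    omega
  · intro h
    by_contra hn
    have : (Finset.range D).filter P ⊆ Finset.range r := by
      intro x hx
      simp at hx ⊢
      by_contra hh
      exact hn (hP _ _ (by omega) hx.2)
    have := Finset.card_le_card this
    simp at this
    omega

def jumps (g : ℕ → ℕ → ℕ) (D i k : ℕ) : ℕ :=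
  ((Finset.range D).filter fun r => g i r = k ∧ g (i + 1) r = k + 1).card

theorem jumps_inj (g g' : ℕ → ℕ → ℕ) (D N q : ℕ)
    (h0 : ∀ r, g 0 r = 0) (h0' : ∀ r, g' 0 r = 0)
    (hs : ∀ i r, g i r ≤ g (i + 1) r ∧ g (i + 1) r ≤ g i r + 1)
    (hs' : ∀ i r, g' i r ≤ g' (i + 1) r ∧ g' (i + 1) r ≤ g' i r + 1)
    (ha : ∀ i, Antitone (g i)) (ha' : ∀ i, Antitone (g' i))
    (hq : ∀ r, g N r ≤ q) (hq' : ∀ r, g' N r ≤ q)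
    (hD : ∀ r, D ≤ r → g N r = 0) (hD' : ∀ r, D ≤ r → g' N r = 0)
    (h : ∀ i < N, ∀ k < q, jumps g D i k = jumps g' D i k) :
    ∀ i ≤ N, g i = g' i := by
  classical
  have mono : ∀ (g : ℕ → ℕ → ℕ), (∀ i r, g i r ≤ g (i + 1) r ∧ g (i + 1) r ≤ g i r + 1) →
      ∀ i ≤ N, ∀ r, g i r ≤ g N r := by
    intro g hs i hi r
    exact monotone_nat_of_le_succ (f := fun i => g i r) (fun i => (hs i r).1) hi
  have rec1 : ∀ (g : ℕ → ℕ → ℕ), (∀ i r, g i r ≤ g (i + 1) r ∧ g (i + 1) r ≤ g i r + 1) →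
      ∀ i k, ((Finset.range D).filter fun r => k < g (i + 1) r).card =
        ((Finset.range D).filter fun r => k < g i r).card + jumps g D i k := by
    intro g hs i k
    unfold jumps
    rw [← Finset.card_union_of_disjoint]
    · congr 1
      ext r
      simp only [Finset.mem_filter, Finset.mem_union]
      have := hs i r
      constructor
      · rintro ⟨h1, h2⟩
        by_cases h3 : k < g i r
        · exact Or.inl ⟨h1, h3⟩
        · exact Or.inr ⟨h1, by omega, by omega⟩
      · rintro (⟨h1, h2⟩ | ⟨h1, h2⟩)
        · exact ⟨h1, by omega⟩
        · exact ⟨h1, by omega⟩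
    · rw [Finset.disjoint_filter]
      intro r _ h1 h2
      omega
  have cnt : ∀ i ≤ N, ∀ k < q, ((Finset.range D).filter fun r => k < g i r).card =
      ((Finset.range D).filter fun r => k < g' i r).card := by
    intro i
    induction i with
    | zero => intro _ k _; simp [h0, h0']
    | succ i ih =>
      intro hi k hk
      rw [rec1 g hs, rec1 g' hs', ih (by omega) k hk, h i (by omega) k hk]
  intro i hi
  funext r
  apply eq_of_forall_lt_iff
  intro k
  have m1 := mono g hs i hi r
  have m2 := mono g' hs' i hi r
  by_cases hr : r < D
  · by_cases hk : k < q
    · rw [count_lt (fun r => k < g i r) (fun r r' hrr hh => lt_of_lt_of_le hh (ha i hrr)) D r hr,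
        count_lt (fun r => k < g' i r) (fun r r' hrr hh => lt_of_lt_of_le hh (ha' i hrr)) D r hr,
        cnt i hi k hk]
    · have := hq r
      have := hq' r
      omega
  · have := hD r (by omega)
    have := hD' r (by omega)
    omega

section GB

variable (K : Type*) [Field K] (q m n : ℕ) (C : ℕ → Prop)

def minorsC (t : ℕ) : Set (MvPolynomial (Fin m × Fin n) K) :=
  { p | ∃ (r : Fin t → Fin m) (c : Fin t → Fin n), StrictMono r ∧ StrictMono c ∧
    (∀ j, C (c j)) ∧ p = Matrix.det (Matrix.of fun i j => X (r i, c j)) }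

open Classical in
noncomputable def phi : MvPolynomial (Fin m × Fin n) K →ₐ[K] MvPolynomial (Vars q m n) K :=
  aeval fun x => if C x.2 then ab K q m n x.1 x.2 else X (Sum.inr (Sum.inr x))

theorem phi_det {p : ℕ} (r : Fin p → Fin m) (c : Fin p → Fin n) (hC : ∀ j, C (c j)) :
    phi K q m n C (Matrix.det (Matrix.of fun i j => X (r i, c j))) =
      Matrix.det (Matrix.of fun i j => ab K q m n (r i) (c j)) := by
  rw [AlgHom.map_det]
  congr 1
  ext1 i j
  simp [phi, hC]

theorem phi_minor {t : ℕ} (ht : q < t) (f : MvPolynomial (Fin m × Fin n) K)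
    (hf : f ∈ Ideal.span (minorsC K m n C t)) : phi K q m n C f = 0 := by
  have : Ideal.span (minorsC K m n C t) ≤ RingHom.ker (phi K q m n C) := by
    rw [Ideal.span_le]
    rintro p ⟨r, c, -, -, hC, rfl⟩
    rw [SetLike.mem_coe, RingHom.mem_ker, phi_det K q m n C r c hC]
    exact det_lt_zero ht _ _
  exact this hf

/-- exponent vectors without strict `t`-chains in the columns `C` -/
def Std (t : ℕ) (e : Fin m × Fin n →₀ ℕ) : Prop :=
  ¬ ∃ (r : Fin t → Fin m) (c : Fin t → Fin n), StrictMono r ∧ StrictMono c ∧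
    (∀ j, C (c j)) ∧ ∀ k, e (r k, c k) ≠ 0

theorem chain_le {m n t : ℕ} (r : Fin t → Fin m) (c : Fin t → Fin n) (hr : StrictMono r)
    (e : Fin m × Fin n →₀ ℕ) :
    (∑ k, Finsupp.single (r k, c k) 1) ≤ e ↔ ∀ k, e (r k, c k) ≠ 0 := by
  classical
  constructor
  · intro h k
    have h1 := h (r k, c k)
    rw [Finsupp.finsetSum_apply] at h1
    have h2 : (Finsupp.single (r k, c k) 1 : Fin m × Fin n →₀ ℕ) (r k, c k) ≤ _ :=
      Finset.single_le_sum (f := fun k' => (Finsupp.single (r k', c k') 1 : Fin m × Fin n →₀ ℕ) (r k, c k))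
        (fun _ _ => Nat.zero_le _) (Finset.mem_univ k)
    rw [Finsupp.single_eq_same] at h2
    omega
  · intro h x
    rw [Finsupp.finsetSum_apply]
    by_cases hx : ∃ k, (r k, c k) = x
    · obtain ⟨k, rfl⟩ := hx
      rw [Finset.sum_eq_single k]
      · rw [Finsupp.single_eq_same]; have := h k; omega
      · intro k' _ hk
        apply Finsupp.single_eq_of_ne
        intro hh
        exact hk (hr.injective (Prod.mk.inj hh).1).symm
      · simp
    · rw [Finset.sum_eq_zero]
      · exact Nat.zero_le _
      · intro k _
        apply Finsupp.single_eq_of_ne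
        intro hh
        exact hx ⟨k, hh.symm⟩

theorem minor_div (t : ℕ) (f : MvPolynomial (Fin m × Fin n) K) :
    ∃ (g : minorsC K m n C t →₀ MvPolynomial (Fin m × Fin n) K) (r : MvPolynomial (Fin m × Fin n) K),
      f = Finsupp.linearCombination _ (fun b : minorsC K m n C t => (b : MvPolynomial _ K)) g + r ∧
      (∀ b : minorsC K m n C t,
        (moX m n).degree ((b : MvPolynomial _ K) * g b) ≼[moX m n] (moX m n).degree f) ∧
      (∀ e ∈ r.support, Std m n C t e) := by
  obtain ⟨g, r, h1, h2, h3⟩ := (moX m n).div_set (B := minorsC K m n C t) (by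
    rintro b ⟨r, c, hr, hc, -, rfl⟩
    rw [(lead_minor K r c hr hc).2]
    exact isUnit_one) f
  refine ⟨g, r, h1, h2, ?_⟩
  rintro e he ⟨r', c', hr, hc, hC, hh⟩
  apply h3 e he _ ⟨r', c', hr, hc, hC, rfl⟩
  rw [(lead_minor K r' c' hr hc).1, chain_le r' c' hr]
  exact hh

theorem lc_mem {t : ℕ} (g : minorsC K m n C t →₀ MvPolynomial (Fin m × Fin n) K) :
    Finsupp.linearCombination _ (fun b : minorsC K m n C t => (b : MvPolynomial _ K)) g
      ∈ Ideal.span (minorsC K m n C t) := by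
  rw [Finsupp.linearCombination_apply]
  apply Submodule.sum_mem
  intro b _
  exact Ideal.mul_mem_left _ _ (Ideal.subset_span b.2)

theorem minor_div_totalDegree (t : ℕ) (f : MvPolynomial (Fin m × Fin n) K) :
    ∃ (r : MvPolynomial (Fin m × Fin n) K),
      f - r ∈ Ideal.span (minorsC K m n C t) ∧ r.totalDegree ≤ f.totalDegree ∧
      (∀ e ∈ r.support, Std m n C t e) := by
  obtain ⟨g, r, h1, h2, h3⟩ := minor_div K m n C t f
  refine ⟨r, ?_, ?_, h3⟩
  · rw [h1, add_sub_cancel_right]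
    exact lc_mem K m n C g
  · apply mord_totalDegree (keyX m n) (keyX_inj m n)
    have hr : r = f - Finsupp.linearCombination _
      (fun b : minorsC K m n C t => (b : MvPolynomial _ K)) g := by
      conv_rhs => rw [h1]
      ring
    rw [hr]
    refine le_trans MonomialOrder.degree_sub_le (sup_le le_rfl ?_)
    rw [Finsupp.linearCombination_apply, Finsupp.sum]
    refine le_trans MonomialOrder.degree_sum_le ?_
    apply Finset.sup_le
    intro b _
    rw [smul_eq_mul, mul_comm]
    exact h2 b

end GB

end SAM

namespace SAM

open MvPolynomial
open scoped MonomialOrder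

theorem exists_jumps (g : ℕ → ℕ) (h0 : g 0 = 0) (hs : ∀ i, g i ≤ g (i + 1) ∧ g (i + 1) ≤ g i + 1)
    (N : ℕ) : ∃ R : Fin (g N) → Fin N, StrictMono R ∧
      ∀ (i : Fin N) (k : Fin (g N)), R k = i ↔ (g i = k ∧ g (i + 1) = k + 1) := by
  have mono : Monotone g := monotone_nat_of_le_succ fun i => (hs i).1
  have h : ∀ k : Fin (g N), ∃ i : Fin N, g i = k ∧ g (i + 1) = k + 1 := by
    intro k
    obtain ⟨i, hi, h1, h2⟩ := exists_jump g h0 hs N k k.2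
    exact ⟨⟨i, hi⟩, h1, h2⟩
  choose R h1 h2 using h
  have key : ∀ (a b : ℕ), g a < g b → a < b := by
    intro a b hab
    by_contra hc
    have := mono (not_lt.mp hc)
    omega
  refine ⟨R, ?_, ?_⟩
  · intro k k' hk
    have hk' : (k : ℕ) < k' := hk
    exact key _ _ (by rw [h1, h1]; exact hk')
  · intro i k
    constructor
    · rintro rfl
      exact ⟨h1 k, h2 k⟩
    · rintro ⟨h3, h4⟩
      have e1 := key (R k) (i + 1) (by rw [h1, h4]; omega)
      have e2 := key i (R k + 1) (by rw [h2, h3]; omega)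
      apply Fin.ext
      omega

theorem totalDegree_minor (K : Type*) [Field K] {m n p : ℕ} (r : Fin p → Fin m) (c : Fin p → Fin n) :
    (Matrix.det (Matrix.of fun i j => X (r i, c j)) : MvPolynomial (Fin m × Fin n) K).totalDegree ≤ p := by
  classical
  rw [Matrix.det_apply']
  apply totalDegree_finsetSum_le
  intro σ _
  refine (totalDegree_mul _ _).trans ?_
  have h1 : (((Equiv.Perm.sign σ : ℤ) : MvPolynomial (Fin m × Fin n) K)).totalDegree = 0 := by
    have : (((Equiv.Perm.sign σ : ℤ) : MvPolynomial (Fin m × Fin n) K)) = C ((Equiv.Perm.sign σ : ℤ) : K) := by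
      simp
    rw [this, totalDegree_C]
  rw [h1, zero_add]
  refine (totalDegree_finsetProd _ _).trans ?_
  refine (Finset.sum_le_sum (g := fun _ => 1) ?_).trans ?_
  · intro i _
    simp
  · simp

section GB

variable (K : Type*) [Field K] (q m n : ℕ) (C : ℕ → Prop)

theorem exists_minor (M : ℕ → ℕ → ℕ) (hM : ∀ i j, ¬ C j → M i j = 0) (r : ℕ) (hq : lam M m n r ≤ q) :
    ∃ f : MvPolynomial (Fin m × Fin n) K, f.totalDegree ≤ lam M m n r ∧ phi K q m n C f ≠ 0 ∧
      (∀ (i : Fin m) (k : Fin q), (moY q m n).degree (phi K q m n C f) (Sum.inl (i, k)) =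
        if lam M i n r = k ∧ lam M (i + 1) n r = k + 1 then 1 else 0) ∧
      (∀ (j : Fin n) (k : Fin q), (moY q m n).degree (phi K q m n C f) (Sum.inr (Sum.inl (k, j))) =
        if lam M m j r = k ∧ lam M m (j + 1) r = k + 1 then 1 else 0) ∧
      (∀ x, (moY q m n).degree (phi K q m n C f) (Sum.inr (Sum.inr x)) = 0) := by
  classical
  obtain ⟨R, hR, hR'⟩ := exists_jumps (fun i => lam M i n r) (lam_zero_left M n r)
    (fun i => (lam_strip M i).2 n r) m
  obtain ⟨D, hD, hD'⟩ := exists_jumps (fun j => lam M m j r) (lam_zero_right M m r)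
    (fun j => (lam_strip M m).1 j r) n
  have hC : ∀ k, C (D k) := by
    intro k
    by_contra hc
    have h1 := (hD' (D k) k).mp rfl
    have h2 := lam_zero_col M (D k) (fun i => hM i _ hc) m r
    omega
  obtain ⟨hl1, hl2⟩ := lead_ab K hq R D hR hD
  refine ⟨Matrix.det (Matrix.of fun i j => X (R i, D j)), totalDegree_minor K R D, ?_, ?_, ?_, ?_⟩
  · rw [phi_det K q m n C R D hC]
    intro h
    rw [h] at hl2
    simp at hl2
  · intro i k
    rw [phi_det K q m n C R D hC, hl1, Finsupp.finsetSum_apply]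
    simp only [Finsupp.add_apply, Finsupp.single_apply, Sum.inl.injEq, Prod.mk.injEq, hR', reduceCtorEq, if_false, add_zero]
    split_ifs with h
    · have hk : (k : ℕ) < lam M m n r := by
        have := lam_mono_left M n r (show (i : ℕ) + 1 ≤ m from i.2)
        simp only at this
        omega
      rw [Finset.sum_eq_single ⟨k, hk⟩]
      · rw [if_pos]
        exact ⟨h, rfl⟩
      · intro b _ hb
        rw [if_neg]
        rintro ⟨-, rfl⟩
        exact hb rfl
      · simp
    · apply Finset.sum_eq_zero
      intro b _
      rw [if_neg]
      rintro ⟨h1, rfl⟩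
      exact h h1
  · intro j k
    rw [phi_det K q m n C R D hC, hl1, Finsupp.finsetSum_apply]
    simp only [Finsupp.add_apply, Finsupp.single_apply, Sum.inl.injEq, Sum.inr.injEq, Prod.mk.injEq, hD', reduceCtorEq, if_false, zero_add]
    split_ifs with h
    · have hk : (k : ℕ) < lam M m n r := by
        have := lam_mono_right M m r (show (j : ℕ) + 1 ≤ n from j.2)
        simp only at this
        omega
      rw [Finset.sum_eq_single ⟨k, hk⟩]
      · rw [if_pos]
        exact ⟨rfl, h⟩
      · intro b _ hb
        rw [if_neg]
        rintro ⟨rfl, -⟩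
        exact hb rfl
      · simp
    · apply Finset.sum_eq_zero
      intro b _
      rw [if_neg]
      rintro ⟨rfl, h1⟩
      exact h h1
  · intro x
    rw [phi_det K q m n C R D hC, hl1, Finsupp.finsetSum_apply]
    simp [Finsupp.single_apply]

open Classical in
noncomputable def toM {m n : ℕ} (C : ℕ → Prop) (e : Fin m × Fin n →₀ ℕ) (i j : ℕ) : ℕ :=
  if h : i < m ∧ j < n ∧ C j then e (⟨i, h.1⟩, ⟨j, h.2.1⟩) else 0

open Classical in
theorem toM_sum (e : Fin m × Fin n →₀ ℕ) :
    ∑ i ∈ Finset.range m, ∑ j ∈ Finset.range n, toM C e i j + (e.filter fun x : Fin m × Fin n => ¬ C x.2).degree = e.degree := by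
  classical
  have h1 : ∑ i ∈ Finset.range m, ∑ j ∈ Finset.range n, toM C e i j = (e.filter fun x => C x.2).degree := by
    rw [Finsupp.degree_eq_sum, Fintype.sum_prod_type, Finset.sum_range]
    apply Finset.sum_congr rfl
    intro i _
    rw [Finset.sum_range]
    apply Finset.sum_congr rfl
    intro j _
    rw [Finsupp.filter_apply]
    simp [toM]
  rw [h1, ← map_add, Finsupp.filter_pos_add_filter_neg]

theorem toM_lam_le (e : Fin m × Fin n →₀ ℕ) (he : Std m n C (q + 1) e) (r : ℕ) :
    lam (toM C e) m n r ≤ q := by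
  classical
  refine le_trans (lam_antitone _ m n (Nat.zero_le r)) ?_
  by_contra hc
  obtain ⟨a, b, h1, h2⟩ := lam_chain (toM C e) m n (q + 1) (by omega)
  apply he
  refine ⟨fun l => ⟨a l, (h1 l l.2).1⟩, fun l => ⟨b l, (h1 l l.2).2.1⟩, ?_, ?_, ?_, ?_⟩
  · intro l l' hl
    exact (h2 l l' hl l'.2).1
  · intro l l' hl
    exact (h2 l l' hl l'.2).2
  · intro l
    have := (h1 l l.2).2.2
    unfold toM at this
    split_ifs at this with hh
    · exact hh.2.2
    · exact absurd rfl this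
  · intro l
    have := (h1 l l.2).2.2
    unfold toM at this
    split_ifs at this with hh
    · exact this
    · exact absurd rfl this

theorem exists_bitab (d : ℕ) (e : Fin m × Fin n →₀ ℕ) (he : Std m n C (q + 1) e) :
    ∃ f : MvPolynomial (Fin m × Fin n) K, f.totalDegree ≤ e.degree ∧ phi K q m n C f ≠ 0 ∧
      (∀ (i : Fin m) (k : Fin q), (moY q m n).degree (phi K q m n C f) (Sum.inl (i, k)) =
        jumps (fun i r => lam (toM C e) i n r) d i k) ∧
      (∀ (j : Fin n) (k : Fin q), (moY q m n).degree (phi K q m n C f) (Sum.inr (Sum.inl (k, j))) =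
        jumps (fun j r => lam (toM C e) m j r) d j k) ∧
      (∀ x, ¬ C x.2 → (moY q m n).degree (phi K q m n C f) (Sum.inr (Sum.inr x)) = e x) := by
  classical
  have hM : ∀ i j, ¬ C j → toM C e i j = 0 := by
    intro i j h
    simp [toM, h]
  choose F f1 f2 f3 f4 f5 using fun r => exists_minor K q m n C (toM C e) hM r (toM_lam_le q m n C e he r)
  set u := e.filter fun x => ¬ C x.2 with hu
  have hphiu : phi K q m n C (monomial u 1) =
      monomial (u.mapDomain fun x => (Sum.inr (Sum.inr x) : Vars q m n)) 1 := by
    rw [monomial_eq, monomial_eq, map_mul, Finsupp.prod_mapDomain_index_inj, map_finsuppProd]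
    · simp only [map_one, one_mul, map_pow]
      apply Finsupp.prod_congr
      intro x hx
      have : ¬ C x.2 := by
        have := Finsupp.mem_support_iff.mp hx
        rw [hu, Finsupp.filter_apply] at this
        by_contra hc
        simp [hc] at this
      simp [phi, this]
    · intro x y h
      simpa using h
  have hne : phi K q m n C (∏ r ∈ Finset.range d, F r) ≠ 0 := by
    rw [map_prod]
    exact Finset.prod_ne_zero_iff.mpr fun r _ => f2 r
  have hne2 : phi K q m n C (monomial u 1) ≠ 0 := by
    rw [hphiu]; simp
  have hdeg : (moY q m n).degree (phi K q m n C ((∏ r ∈ Finset.range d, F r) * monomial u 1)) =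
      ∑ r ∈ Finset.range d, (moY q m n).degree (phi K q m n C (F r)) +
        u.mapDomain fun x => (Sum.inr (Sum.inr x) : Vars q m n) := by
    rw [map_mul, MonomialOrder.degree_mul hne hne2, map_prod, MonomialOrder.degree_prod (fun r _ => f2 r), hphiu,
      MonomialOrder.degree_monomial, if_neg one_ne_zero]
  refine ⟨(∏ r ∈ Finset.range d, F r) * monomial u 1, ?_, ?_, ?_, ?_, ?_⟩
  · refine (totalDegree_mul _ _).trans ?_
    rw [← toM_sum m n C e]
    apply add_le_add
    · refine (totalDegree_finsetProd _ _).trans ?_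
      refine (Finset.sum_le_sum fun r _ => f1 r).trans ?_
      exact lam_sum_le _ _ _ _ _ le_rfl
    · refine (totalDegree_monomial_le _ _).trans ?_
      rfl
  · rw [map_mul]
    exact mul_ne_zero hne hne2
  · intro i k
    rw [hdeg, Finsupp.add_apply, Finsupp.finsetSum_apply, Finsupp.mapDomain_of_notMem_range _ _ (by simp)]
    simp only [f3, jumps, Finset.card_filter, add_zero]
  · intro i k
    rw [hdeg, Finsupp.add_apply, Finsupp.finsetSum_apply, Finsupp.mapDomain_of_notMem_range _ _ (by simp)]
    simp only [f4, jumps, Finset.card_filter, add_zero]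
  · intro x hx
    rw [hdeg, Finsupp.add_apply, Finsupp.finsetSum_apply]
    rw [Finsupp.mapDomain_apply (by intro x y h; simpa using h)]
    simp [f5, hu, hx]

theorem bitab_inj (d : ℕ) (e e' : Fin m × Fin n →₀ ℕ) (he : Std m n C (q + 1) e)
    (he' : Std m n C (q + 1) e') (hd : e.degree ≤ d) (hd' : e'.degree ≤ d)
    (h1 : ∀ (i : Fin m) (k : Fin q), jumps (fun i r => lam (toM C e) i n r) d i k =
      jumps (fun i r => lam (toM C e') i n r) d i k)
    (h2 : ∀ (j : Fin n) (k : Fin q), jumps (fun j r => lam (toM C e) m j r) d j k =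
      jumps (fun j r => lam (toM C e') m j r) d j k)
    (h3 : ∀ x, ¬ C x.2 → e x = e' x) : e = e' := by
  have z : ∀ e : Fin m × Fin n →₀ ℕ, e.degree ≤ d → ∀ r, d ≤ r → lam (toM C e) m n r = 0 := by
    intro e hd r hr
    refine lam_eq_zero _ _ _ d ?_ r hr
    have := toM_sum m n C e
    omega
  have e1 := jumps_inj (fun i r => lam (toM C e) i n r) (fun i r => lam (toM C e') i n r) d m q
    (fun r => lam_zero_left _ _ _) (fun r => lam_zero_left _ _ _)
    (fun i r => (lam_strip _ i).2 n r) (fun i r => (lam_strip _ i).2 n r)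
    (fun i => lam_antitone _ i n) (fun i => lam_antitone _ i n)
    (toM_lam_le q m n C e he) (toM_lam_le q m n C e' he') (z e hd) (z e' hd')
    (fun i hi k hk => h1 ⟨i, hi⟩ ⟨k, hk⟩)
  have e2 := jumps_inj (fun j r => lam (toM C e) m j r) (fun j r => lam (toM C e') m j r) d n q
    (fun r => lam_zero_right _ _ _) (fun r => lam_zero_right _ _ _)
    (fun i r => (lam_strip _ m).1 i r) (fun i r => (lam_strip _ m).1 i r)
    (fun i => lam_antitone _ m i) (fun i => lam_antitone _ m i)
    (toM_lam_le q m n C e he) (toM_lam_le q m n C e' he') (z e hd) (z e' hd')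
    (fun j hj k hk => h2 ⟨j, hj⟩ ⟨k, hk⟩)
  have e3 := lam_inj (toM C e) (toM C e') m n d e1 e2 (z e hd)
  ext x
  by_cases hC : C x.2
  · have := e3 x.1 x.1.2 x.2 x.2.2
    simpa [toM, hC] using this
  · exact h3 x hC

end GB

end SAM

namespace SAM

open MvPolynomial
open scoped MonomialOrder

section GB

variable (K : Type*) [Field K] (q m n : ℕ) (C : ℕ → Prop)

theorem std_indep (d : ℕ) : LinearIndependent K
    (fun e : {e : Fin m × Fin n →₀ ℕ // Std m n C (q + 1) e ∧ e.degree ≤ d} =>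
      phi K q m n C (monomial e.1 1)) := by
  classical
  have hfin : {e : Fin m × Fin n →₀ ℕ | Std m n C (q + 1) e ∧ e.degree ≤ d}.Finite := by
    refine Set.Finite.subset (Finsupp.finite_of_degree_le d) ?_
    intro e he
    exact he.2
  let _ : Fintype {e : Fin m × Fin n →₀ ℕ // Std m n C (q + 1) e ∧ e.degree ≤ d} := hfin.fintype
  choose f f1 f2 f3 f4 f5 using
    fun e : {e : Fin m × Fin n →₀ ℕ // Std m n C (q + 1) e ∧ e.degree ≤ d} =>
      exists_bitab K q m n C d e.1 e.2.1
  have hli : LinearIndependent K fun e => phi K q m n C (f e) := by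
    apply linInd_of_degree (moY q m n) _ f2
    intro e e' h
    simp only at h
    apply Subtype.ext
    apply bitab_inj q m n C d e.1 e'.1 e.2.1 e'.2.1 e.2.2 e'.2.2
    · intro i k
      rw [← f3, ← f3, h]
    · intro i k
      rw [← f4, ← f4, h]
    · intro x hx
      rw [← f5 e x hx, ← f5 e' x hx, h]
  set b := fun e : {e : Fin m × Fin n →₀ ℕ // Std m n C (q + 1) e ∧ e.degree ≤ d} =>
      phi K q m n C (monomial e.1 1) with hb
  have hmem : ∀ e, phi K q m n C (f e) ∈ Submodule.span K (Set.range b) := by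
    intro e
    obtain ⟨r, h1, h2, h3⟩ := minor_div_totalDegree K m n C (q + 1) (f e)
    have h4 : phi K q m n C (f e) = phi K q m n C r := by
      rw [← sub_eq_zero, ← map_sub]
      exact phi_minor K q m n C (Nat.lt_succ_self q) _ h1
    rw [h4, r.as_sum, map_sum]
    apply Submodule.sum_mem
    intro u hu
    have hud : u.degree ≤ d := by
      refine le_trans ?_ (h2.trans ((f1 e).trans e.2.2))
      exact le_totalDegree hu
    have h5 : phi K q m n C (monomial u (coeff u r)) = coeff u r • b ⟨u, h3 u hu, hud⟩ := by
      rw [hb]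
      simp only
      rw [← map_smul, smul_monomial, smul_eq_mul, mul_one]
    rw [h5]
    exact Submodule.smul_mem _ _ (Submodule.subset_span ⟨_, rfl⟩)
  rw [linearIndependent_iff_card_eq_finrank_span]
  apply le_antisymm
  · let g : {e : Fin m × Fin n →₀ ℕ // Std m n C (q + 1) e ∧ e.degree ≤ d} →
        Submodule.span K (Set.range b) := fun e => ⟨_, hmem e⟩
    have hg : LinearIndependent K g := by
      apply LinearIndependent.of_comp (Submodule.span K (Set.range b)).subtype
      exact hli
    have : Module.Finite K (Submodule.span K (Set.range b)) :=
      Module.Finite.span_of_finite K (Set.finite_range b)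
    exact hg.fintype_card_le_finrank
  · exact finrank_range_le_card b

theorem std_zero (r : MvPolynomial (Fin m × Fin n) K) (hr : ∀ e ∈ r.support, Std m n C (q + 1) e)
    (h0 : phi K q m n C r = 0) : r = 0 := by
  classical
  have hli := std_indep K q m n C r.totalDegree
  rw [linearIndependent_iff'] at hli
  have hd : ∀ e ∈ r.support, Std m n C (q + 1) e ∧ e.degree ≤ r.totalDegree :=
    fun e he => ⟨hr e he, le_totalDegree he⟩
  have h1 := hli (r.support.subtype _) (fun e => coeff e.1 r) (by
    rw [Finset.sum_subtype_of_mem (p := fun e => Std m n C (q + 1) e ∧ e.degree ≤ r.totalDegree)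
      (fun e => coeff e r • phi K q m n C (monomial e 1)) hd]
    conv_rhs => rw [← h0]
    conv_rhs => rw [r.as_sum, map_sum]
    apply Finset.sum_congr rfl
    intro u _
    rw [← map_smul, smul_monomial, smul_eq_mul, mul_one])
  ext e
  rw [coeff_zero]
  by_contra hne
  have he : e ∈ r.support := mem_support_iff.mpr hne
  exact hne (h1 ⟨e, hd e he⟩ (by simpa using hne))

theorem gb (f : MvPolynomial (Fin m × Fin n) K) (hf : f ∈ Ideal.span (minorsC K m n C (q + 1)))
    (h0 : f ≠ 0) : ¬ Std m n C (q + 1) ((moX m n).degree f) := by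
  classical
  obtain ⟨g, r, h1, h2, h3⟩ := minor_div K m n C (q + 1) f
  have hr : r = 0 := by
    apply std_zero K q m n C r h3
    apply phi_minor K q m n C (Nat.lt_succ_self q)
    have : r = f - Finsupp.linearCombination _
      (fun b : minorsC K m n C (q + 1) => (b : MvPolynomial _ K)) g := by
      conv_rhs => rw [h1]
      ring
    rw [this]
    exact Ideal.sub_mem _ hf (lc_mem K m n C g)
  rw [hr, add_zero, Finsupp.linearCombination_apply, Finsupp.sum] at h1
  have hc : coeff ((moX m n).degree f) f ≠ 0 := fun h => h0 ((moX m n).coeff_degree_eq_zero_iff.mp h)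
  have hc2 : ∃ b ∈ g.support, coeff ((moX m n).degree f) (g b • (b : MvPolynomial _ K)) ≠ 0 := by
    by_contra hh
    push Not at hh
    apply hc
    conv_lhs => rw [h1]
    rw [coeff_sum]
    apply Finset.sum_eq_zero
    intro b hb
    rw [← h1]
    exact hh b hb
  obtain ⟨b, hb, hbc⟩ := hc2
  rw [smul_eq_mul, mul_comm] at hbc
  have e1 : (moX m n).degree f = (moX m n).degree ((b : MvPolynomial _ K) * g b) := by
    apply (moX m n).toSyn.injective
    apply le_antisymm
    · exact (moX m n).le_degree (mem_support_iff.mpr hbc)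
    · exact h2 b
  obtain ⟨r', c', hr', hc', hC', hbe⟩ := b.2
  intro hstd
  apply hstd
  refine ⟨r', c', hr', hc', hC', ?_⟩
  rw [← chain_le r' c' hr', ← (lead_minor K r' c' hr' hc').1, ← hbe, e1, MonomialOrder.degree_mul]
  · exact le_self_add
  · intro h
    rw [h] at hbc
    simp at hbc
  · exact Finsupp.mem_support_iff.mp hb

end GB

end SAM

namespace SAM

open MvPolynomial
open scoped MonomialOrder

theorem strictMono_glue {N t : ℕ} (k : ℕ) (u v : Fin t → Fin N) (w : Fin t → Fin N)
    (hw : ∀ l, w l = if l.val < k then u l else v l)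
    (hu : ∀ l l' : Fin t, l < l' → l'.val < k → u l < u l')
    (hv : ∀ l l' : Fin t, l < l' → k ≤ l.val → v l < v l')
    (huv : ∀ l l' : Fin t, l.val + 1 = k → l'.val = k → u l < v l') : StrictMono w := by
  have step : ∀ (l : ℕ) (h : l + 1 < t), w ⟨l, by omega⟩ < w ⟨l + 1, h⟩ := by
    intro l h
    rw [hw, hw]
    simp only
    split_ifs with h1 h2 h2
    · exact hu _ _ (by simp) h2
    · exact huv _ _ (by simp only; omega) (by simp only; omega)
    · omega
    · exact hv _ _ (by simp) (by simp only; omega)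
  cases t with
  | zero => intro a; exact a.elim0
  | succ t =>
    rw [Fin.strictMono_iff_lt_succ]
    intro i
    exact step i (by omega)

/-- combining a `(t+1)`-chain with a `t`-chain in the middle columns -/
theorem chain_comb {m n t : ℕ} (a b : ℕ) (P : Fin m × Fin n → Prop)
    (r : Fin (t + 1) → Fin m) (c : Fin (t + 1) → Fin n) (hr : StrictMono r) (hc : StrictMono c)
    (hcb : ∀ j, a ≤ (c j : ℕ) ∧ (c j : ℕ) ≤ b) (hP : ∀ k, P (r k, c k))
    (p : Fin t → Fin m) (d : Fin t → Fin n) (hp : StrictMono p) (hd : StrictMono d)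
    (hdb : ∀ j, a + 1 ≤ (d j : ℕ) ∧ (d j : ℕ) + 1 ≤ b) (hP' : ∀ k, P (p k, d k)) (ht : 0 < t) :
    ∃ (r : Fin (t + 1) → Fin m) (c : Fin (t + 1) → Fin n), StrictMono r ∧ StrictMono c ∧
      (∀ k, P (r k, c k)) ∧
      ((∀ j, a ≤ (c j : ℕ) ∧ (c j : ℕ) + 1 ≤ b) ∨ (∀ j, a + 1 ≤ (c j : ℕ) ∧ (c j : ℕ) ≤ b)) := by
  classical
  by_cases h1 : ∃ k : Fin t, r k.castSucc < p k ∧ c k.castSucc < d k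
  · obtain ⟨k, hk1, hk2⟩ := h1
    -- c_0..c_k, d_k..d_{t-1}
    let pr : Fin (t + 1) → Fin t := fun l => ⟨l.val - 1, by omega⟩
    refine ⟨fun l => if l.val < k.val + 1 then r l else p (pr l),
      fun l => if l.val < k.val + 1 then c l else d (pr l), ?_, ?_, ?_, Or.inl ?_⟩
    · apply strictMono_glue (k.val + 1) r (fun l => p (pr l)) _ (fun l => rfl)
      · intro l l' h _
        exact hr h
      · intro l l' h h'
        apply hp
        have : l.val < l'.val := h
        change l.val - 1 < l'.val - 1
        omega
      · intro l l' h h'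
        have e1 : l = k.castSucc := Fin.ext (by simp; omega)
        have e2 : pr l' = k := Fin.ext (by simp [pr]; omega)
        rw [e1, e2]
        exact hk1
    · apply strictMono_glue (k.val + 1) c (fun l => d (pr l)) _ (fun l => rfl)
      · intro l l' h _
        exact hc h
      · intro l l' h h'
        apply hd
        have : l.val < l'.val := h
        change l.val - 1 < l'.val - 1
        omega
      · intro l l' h h'
        have e1 : l = k.castSucc := Fin.ext (by simp; omega)
        have e2 : pr l' = k := Fin.ext (by simp [pr]; omega)
        rw [e1, e2]
        exact hk2
    · intro l
      simp only
      split_ifs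
      · exact hP l
      · exact hP' _
    · intro l
      simp only
      split_ifs with h
      · refine ⟨(hcb l).1, ?_⟩
        have e1 : c l ≤ c k.castSucc := hc.monotone (by change l.val ≤ k.val; omega)
        have e2 := (hdb k).2
        have e3 : (c l : ℕ) ≤ c k.castSucc := e1
        have e4 : (c k.castSucc : ℕ) < d k := hk2
        omega
      · have := hdb (pr l)
        omega
  by_cases h2 : ∃ k : Fin t, p k < r k.succ ∧ d k < c k.succ
  · obtain ⟨k, hk1, hk2⟩ := h2
    -- d_0..d_k, c_{k+1}..c_t
    let pr : Fin (t + 1) → Fin t := fun l => ⟨min l.val (t - 1), by omega⟩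
    refine ⟨fun l => if l.val < k.val + 1 then p (pr l) else r l,
      fun l => if l.val < k.val + 1 then d (pr l) else c l, ?_, ?_, ?_, Or.inr ?_⟩
    · apply strictMono_glue (k.val + 1) (fun l => p (pr l)) r _ (fun l => rfl)
      · intro l l' h h'
        apply hp
        have : l.val < l'.val := h
        change min l.val (t - 1) < min l'.val (t - 1)
        have := k.2
        omega
      · intro l l' h _
        exact hr h
      · intro l l' h h'
        have e1 : pr l = k := Fin.ext (by simp [pr]; omega)
        have e2 : l' = k.succ := Fin.ext (by simp; omega)
        rw [e1, e2]
        exact hk1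
    · apply strictMono_glue (k.val + 1) (fun l => d (pr l)) c _ (fun l => rfl)
      · intro l l' h h'
        apply hd
        have : l.val < l'.val := h
        change min l.val (t - 1) < min l'.val (t - 1)
        have := k.2
        omega
      · intro l l' h _
        exact hc h
      · intro l l' h h'
        have e1 : pr l = k := Fin.ext (by simp [pr]; omega)
        have e2 : l' = k.succ := Fin.ext (by simp; omega)
        rw [e1, e2]
        exact hk2
    · intro l
      simp only
      split_ifs
      · exact hP' _
      · exact hP l
    · intro l
      simp only
      split_ifs with h
      · have := hdb (pr l)
        omega
      · refine ⟨?_, (hcb l).2⟩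
        have e1 : c k.succ ≤ c l := hc.monotone (by change k.val + 1 ≤ l.val; omega)
        have e2 := (hdb k).1
        have e3 : (c k.succ : ℕ) ≤ c l := e1
        have e4 : (d k : ℕ) < c k.succ := hk2
        omega
  push Not at h1 h2
  by_cases h3 : (c 0 : ℕ) = a
  swap
  · refine ⟨r, c, hr, hc, hP, Or.inr fun j => ⟨?_, (hcb j).2⟩⟩
    have e1 : (c 0 : ℕ) ≤ c j := hc.monotone (Fin.zero_le j)
    have := (hcb 0).1
    omega
  by_cases h4 : (c (Fin.last t) : ℕ) = b
  swap
  · refine ⟨r, c, hr, hc, hP, Or.inl fun j => ⟨(hcb j).1, ?_⟩⟩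
    have e1 : (c j : ℕ) ≤ c (Fin.last t) := hc.monotone (Fin.le_last j)
    have := (hcb (Fin.last t)).2
    omega
  exfalso
  have key : ∀ (k : ℕ) (hk : k < t), c (Fin.succ ⟨k, hk⟩) ≤ d ⟨k, hk⟩ := by
    intro k
    have fin : ∀ (hk : k < t), c (Fin.castSucc ⟨k, hk⟩) < d ⟨k, hk⟩ → c (Fin.succ ⟨k, hk⟩) ≤ d ⟨k, hk⟩ := by
      intro hk hlt
      have e1 : p ⟨k, hk⟩ ≤ r (Fin.castSucc ⟨k, hk⟩) := by
        by_contra hh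
        exact absurd hlt (not_lt.mpr (h1 ⟨k, hk⟩ (not_le.mp hh)))
      exact h2 ⟨k, hk⟩ (lt_of_le_of_lt e1 (hr (Fin.castSucc_lt_succ)))
    induction k with
    | zero =>
      intro hk
      apply fin hk
      have := (hdb ⟨0, hk⟩).1
      change (c 0 : ℕ) < d ⟨0, hk⟩
      omega
    | succ k ih =>
      intro hk
      apply fin hk
      refine lt_of_le_of_lt (b := d ⟨k, by omega⟩) ?_ (hd ?_)
      · refine ih ?_ (by omega)
        intro hk hlt
        have e1 : p ⟨k, hk⟩ ≤ r (Fin.castSucc ⟨k, hk⟩) := by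
          by_contra hh
          exact absurd hlt (not_lt.mpr (h1 ⟨k, hk⟩ (not_le.mp hh)))
        exact h2 ⟨k, hk⟩ (lt_of_le_of_lt e1 (hr (Fin.castSucc_lt_succ)))
      · change k < k + 1
        omega
  have e1 := key (t - 1) (by omega)
  have e2 := (hdb ⟨t - 1, by omega⟩).2
  have e3 : Fin.succ ⟨t - 1, by omega⟩ = Fin.last t := Fin.ext (by simp; omega)
  rw [e3] at e1
  have e4 : (c (Fin.last t) : ℕ) ≤ d ⟨t - 1, by omega⟩ := e1
  omega

section GB

variable (K : Type*) [Field K] (m n : ℕ)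

theorem minorsC_mono {C C' : ℕ → Prop} (h : ∀ j, C j → C' j) (t : ℕ) :
    minorsC K m n C t ⊆ minorsC K m n C' t := by
  rintro p ⟨r, c, hr, hc, hC, rfl⟩
  exact ⟨r, c, hr, hc, fun j => h _ (hC j), rfl⟩

theorem laplace {C C' : ℕ → Prop} (t : ℕ) (j0 : Fin (t + 1))
    (h : ∀ c : Fin (t + 1) → Fin n, StrictMono c → (∀ j, C (c j)) → ∀ j, C' (c (j0.succAbove j))) :
    Ideal.span (minorsC K m n C (t + 1)) ≤ Ideal.span (minorsC K m n C' t) := by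
  rw [Ideal.span_le]
  rintro p ⟨r, c, hr, hc, hC, rfl⟩
  rw [SetLike.mem_coe, Matrix.det_succ_column _ j0]
  apply Submodule.sum_mem
  intro i _
  apply Ideal.mul_mem_left
  apply Ideal.subset_span
  exact ⟨fun k => r (i.succAbove k), fun k => c (j0.succAbove k),
    hr.comp (Fin.strictMono_succAbove i), hc.comp (Fin.strictMono_succAbove j0), h c hc hC, rfl⟩

theorem main (t : ℕ) (ht : 0 < t) (a b : ℕ) :
    Ideal.span (minorsC K m n (fun j => a ≤ j ∧ j + 1 ≤ b) (t + 1)) ⊔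
      Ideal.span (minorsC K m n (fun j => a + 1 ≤ j ∧ j ≤ b) (t + 1)) =
    Ideal.span (minorsC K m n (fun j => a ≤ j ∧ j ≤ b) (t + 1)) ⊓
      Ideal.span (minorsC K m n (fun j => a + 1 ≤ j ∧ j + 1 ≤ b) t) := by
  classical
  have hle : Ideal.span (minorsC K m n (fun j => a ≤ j ∧ j + 1 ≤ b) (t + 1)) ⊔
      Ideal.span (minorsC K m n (fun j => a + 1 ≤ j ∧ j ≤ b) (t + 1)) ≤
    Ideal.span (minorsC K m n (fun j => a ≤ j ∧ j ≤ b) (t + 1)) ⊓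
      Ideal.span (minorsC K m n (fun j => a + 1 ≤ j ∧ j + 1 ≤ b) t) := by
    refine le_inf (sup_le ?_ ?_) (sup_le ?_ ?_)
    · exact Ideal.span_mono (minorsC_mono K m n (fun j h => ⟨h.1, by omega⟩) _)
    · exact Ideal.span_mono (minorsC_mono K m n (fun j h => ⟨by omega, h.2⟩) _)
    · apply laplace K m n t 0
      intro c hc hC j
      refine ⟨?_, (hC _).2⟩
      have h1 := (hC 0).1
      have h2 : (c 0 : ℕ) < c ((0 : Fin (t + 1)).succAbove j) := by
        apply hc
        rw [Fin.succAbove_zero]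
        exact Fin.succ_pos j
      omega
    · apply laplace K m n t (Fin.last t)
      intro c hc hC j
      refine ⟨(hC _).1, ?_⟩
      have h1 := (hC (Fin.last t)).2
      have h2 : (c ((Fin.last t).succAbove j) : ℕ) < c (Fin.last t) := by
        apply hc
        rw [Fin.succAbove_last]
        exact Fin.castSucc_lt_last j
      omega
  refine le_antisymm hle ?_
  intro g hg
  set B := minorsC K m n (fun j => a ≤ j ∧ j + 1 ≤ b) (t + 1) ∪
    minorsC K m n (fun j => a + 1 ≤ j ∧ j ≤ b) (t + 1) with hB
  obtain ⟨u, r, h1, -, h3⟩ := (moX m n).div_set (B := B) (by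
    rintro f (⟨r, c, hr, hc, -, rfl⟩ | ⟨r, c, hr, hc, -, rfl⟩)
    · rw [(lead_minor K r c hr hc).2]
      exact isUnit_one
    · rw [(lead_minor K r c hr hc).2]
      exact isUnit_one) g
  have hmem : Finsupp.linearCombination _ (fun f : B => (f : MvPolynomial _ K)) u ∈
      Ideal.span (minorsC K m n (fun j => a ≤ j ∧ j + 1 ≤ b) (t + 1)) ⊔
      Ideal.span (minorsC K m n (fun j => a + 1 ≤ j ∧ j ≤ b) (t + 1)) := by
    rw [Finsupp.linearCombination_apply]
    apply Submodule.sum_mem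
    intro f _
    apply Ideal.mul_mem_left
    rw [← Ideal.span_union]
    exact Ideal.subset_span f.2
  have hr : r = 0 := by
    by_contra hne
    have hrm : r ∈ Ideal.span (minorsC K m n (fun j => a ≤ j ∧ j ≤ b) (t + 1)) ⊓
      Ideal.span (minorsC K m n (fun j => a + 1 ≤ j ∧ j + 1 ≤ b) t) := by
      have : r = g - Finsupp.linearCombination _ (fun f : B => (f : MvPolynomial _ K)) u := by
        conv_rhs => rw [h1]
        ring
      rw [this]
      exact Ideal.sub_mem _ hg (hle hmem)
    obtain ⟨t', rfl⟩ : ∃ t', t = t' + 1 := ⟨t - 1, by omega⟩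
    have g1 := gb K (t' + 1) m n _ r hrm.1 hne
    have g2 := gb K t' m n _ r hrm.2 hne
    unfold Std at g1 g2
    rw [not_not] at g1 g2
    obtain ⟨r1, c1, hr1, hc1, hC1, hP1⟩ := g1
    obtain ⟨r2, c2, hr2, hc2, hC2, hP2⟩ := g2
    obtain ⟨r', c', hr', hc', hP, hor⟩ := chain_comb a b (fun x => (moX m n).degree r x ≠ 0)
      r1 c1 hr1 hc1 hC1 hP1 r2 c2 hr2 hc2 hC2 hP2 (by omega)
    apply h3 _ ((moX m n).degree_mem_support hne)
      (Matrix.det (Matrix.of fun i j => X (r' i, c' j)))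
    · rcases hor with h | h
      · exact Or.inl ⟨r', c', hr', hc', h, rfl⟩
      · exact Or.inr ⟨r', c', hr', hc', h, rfl⟩
    · rw [(lead_minor K r' c' hr' hc').1, chain_le r' c' hr']
      exact hP
  rw [h1, hr, add_zero]
  exact hmem

end GB

end SAM

theorem SAM.genMinors_eq (K : Type*) [Field K] (m n t c1 c2 : ℕ) (C : ℕ → Prop)
    (h : ∀ j, C j ↔ (c1 ≤ j + 1 ∧ j + 1 ≤ c2)) :
    genMinors K m n t 1 m c1 c2 = Ideal.span (SAM.minorsC K m n C t) := by
  unfold genMinors SAM.minorsC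
  congr 1
  ext p
  constructor
  · rintro ⟨r, c, hr, hc, -, hC, hp⟩
    exact ⟨r, c, hr, hc, fun j => (h _).mpr (hC j), hp⟩
  · rintro ⟨r, c, hr, hc, hC, hp⟩
    exact ⟨r, c, hr, hc, fun i => ⟨by omega, (r i).2⟩, fun j => (h _).mp (hC j), hp⟩

/-- For every width `s ≥ t` and starting column `a` with `1 ≤ a` and `a + s ≤ n`:
`I_t(X_{[a,a+s-1]}) + I_t(X_{[a+1,a+s]}) = I_t(X_{[a,a+s]}) ∩ I_{t-1}(X_{[a+1,a+s-1]})`. -/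
theorem sum_adjacent_minors_general (K : Type*) [Field K] (m n : ℕ)
    (hm : 0 < m) (hmn : m ≤ n) (t : ℕ) (ht2 : 2 ≤ t) (htm : t ≤ m)
    (s a : ℕ) (hts : t ≤ s) (ha : 1 ≤ a) (han : a + s ≤ n) :
    genMinors K m n t 1 m a (a + s - 1) + genMinors K m n t 1 m (a + 1) (a + s)
      = genMinors K m n t 1 m a (a + s) ⊓ genMinors K m n (t - 1) 1 m (a + 1) (a + s - 1) := by
  obtain ⟨t, rfl⟩ : ∃ t', t = t' + 1 := ⟨t - 1, by omega⟩
  rw [SAM.genMinors_eq K m n _ a (a + s - 1) (fun j => a - 1 ≤ j ∧ j + 1 ≤ a + s - 1) (by omega),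
    SAM.genMinors_eq K m n _ (a + 1) (a + s) (fun j => a - 1 + 1 ≤ j ∧ j ≤ a + s - 1) (by omega),
    SAM.genMinors_eq K m n _ a (a + s) (fun j => a - 1 ≤ j ∧ j ≤ a + s - 1) (by omega),
    SAM.genMinors_eq K m n _ (a + 1) (a + s - 1)
      (fun j => a - 1 + 1 ≤ j ∧ j + 1 ≤ a + s - 1) (by omega)]
  exact SAM.main K m n t (by omega) (a - 1) (a + s - 1)
end

section
/- Let K be a field, m < n positive integers, X the m×n generic matrix over S = K[x_{ij}], and t ≤ m. For each i with m−t+1 ≤ i ≤ n−m+1, the determinantal ideal I_t(X_{[i,t+i−1]}) is a minimal prime of the ideal H = (det X_{[i,i+m−1]}, det X_{[i−1,i+m−2]}, ..., det X_{[i−m+t,i+t−1]}) of S generated by the m−t+1 maximal minors of X on the indicated windows of m consecutive columns. -/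
namespace AdjMin

open MvPolynomial

/-- the `c`-th column of the window starting at offset `o` -/
def col {n k : ℕ} (o : ℕ) (h : o + k < n) (c : Fin (k + 1)) : Fin n := ⟨o + c.val, by omega⟩

/-- ideal of maximal minors of the window of `k+1` columns with offset `o` -/
noncomputable def J (K : Type*) [Field K] (m : ℕ) {n k : ℕ} (o : ℕ) (h : o + k < n) :
    Ideal (MvPolynomial (Fin m × Fin n) K) :=
  Ideal.span { p | ∃ r : Fin (k + 1) → Fin m, StrictMono r ∧
    p = Matrix.det (Matrix.of fun a b => X (r a, col o h b)) }

theorem genMinors_eq (K : Type*) [Field K] (m : ℕ) {n k : ℕ} (o : ℕ) (h : o + k < n) :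
    genMinors K m n (k + 1) 1 m (o + 1) (k + 1 + (o + 1) - 1) = J K m o h := by
  unfold genMinors J
  congr 1
  ext p
  constructor
  · rintro ⟨r, c, hr, hc, -, hc2, rfl⟩
    refine ⟨r, hr, ?_⟩
    have key : c = col o h := by
      let d : Fin (k + 1) → Fin (k + 1) := fun j => ⟨(c j).val - o, by have := hc2 j; omega⟩
      have hd : StrictMono d := by
        intro a b hab
        have h1 := hc hab
        have h2 := hc2 a
        have h3 := hc2 b
        simp only [d, Fin.lt_def] at *
        omega
      have hd' : d = id := by
        have hb : Function.Bijective d := Finite.injective_iff_bijective.mp hd.injective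
        exact (StrictMono.range_inj hd strictMono_id).mp (by
          rw [hb.surjective.range_eq, Set.range_id])
      funext j
      have h1 := congrFun hd' j
      have h2 := hc2 j
      simp only [d, id, Fin.ext_iff] at h1
      simp only [col, Fin.ext_iff]
      omega
    rw [key]
  · rintro ⟨r, hr, rfl⟩
    refine ⟨r, col o h, hr, ?_, ?_, ?_, rfl⟩
    · intro a b hab
      simp only [col, Fin.lt_def] at *
      omega
    · intro i
      have := (r i).isLt
      omega
    · intro j
      have := j.isLt
      simp only [col]
      omega

/-- substitution making the last column of the window dependent on the others -/
noncomputable def phi (K : Type*) [Field K] (m : ℕ) {n k : ℕ} (o : ℕ) (h : o + k < n) :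
    MvPolynomial (Fin m × Fin n) K →ₐ[K] MvPolynomial ((Fin m × Fin n) ⊕ Fin k) K :=
  aeval fun s => if s.2.val = o + k then
      ∑ c : Fin k, X (Sum.inl (s.1, col o h c.castSucc)) * X (Sum.inr c)
    else X (Sum.inl s)

noncomputable def lam (K : Type*) [Field K] (m n k : ℕ) (c : Fin (k + 1)) :
    MvPolynomial ((Fin m × Fin n) ⊕ Fin k) K :=
  if hc : c.val < k then X (Sum.inr ⟨c.val, hc⟩) else -1

theorem phi_row (K : Type*) [Field K] (m : ℕ) {n k : ℕ} (o : ℕ) (h : o + k < n) (r : Fin m) :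
    ∑ c : Fin (k + 1), phi K m o h (X (r, col o h c)) * lam K m n k c = 0 := by
  rw [Fin.sum_univ_castSucc]
  have h1 : phi K m o h (X (r, col o h (Fin.last k))) =
      ∑ c : Fin k, X (Sum.inl (r, col o h c.castSucc)) * X (Sum.inr c) := by
    simp [phi, col]
  have h2 : ∀ c : Fin k, phi K m o h (X (r, col o h c.castSucc)) =
      X (Sum.inl (r, col o h c.castSucc)) := by
    intro c
    have := c.isLt
    simp only [phi, aeval_X]
    rw [if_neg]
    simp only [col, Fin.val_castSucc]
    omega
  have h3 : lam K m n k (Fin.last k) = -1 := by simp [lam]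
  have h4 : ∀ c : Fin k, lam K m n k c.castSucc = X (Sum.inr c) := by
    intro c; simp [lam]
  rw [h1, h3]
  simp only [h2, h4]
  ring

theorem phi_det (K : Type*) [Field K] (m : ℕ) {n k : ℕ} (o : ℕ) (h : o + k < n)
    {q : ℕ} (r : Fin q → Fin m) (γ : Fin q → Fin n) (δ : Fin (k + 1) → Fin q)
    (hδ : Function.Injective δ) (hγ : ∀ c, γ (δ c) = col o h c) :
    phi K m o h (Matrix.det (Matrix.of fun a b => X (r a, γ b))) = 0 := by
  rw [AlgHom.map_det, ← Matrix.exists_mulVec_eq_zero_iff]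
  refine ⟨fun b => ∑ c, if δ c = b then lam K m n k c else 0, ?_, ?_⟩
  · intro h0
    have h1 := congrFun h0 (δ (Fin.last k))
    simp only [hδ.eq_iff, Finset.sum_ite_eq', Finset.mem_univ, if_true, Pi.zero_apply] at h1
    simp [lam] at h1
  · funext a
    simp only [Matrix.mulVec, dotProduct, Pi.zero_apply, AlgHom.mapMatrix_apply, Matrix.map_apply,
      Matrix.of_apply, Finset.mul_sum]
    rw [Finset.sum_comm]
    simp only [mul_ite, mul_zero, Finset.sum_ite_eq, Finset.mem_univ, if_true, hγ]
    exact phi_row K m o h (r a)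

theorem J_le_ker (K : Type*) [Field K] (m : ℕ) {n k : ℕ} (o : ℕ) (h : o + k < n) :
    J K m o h ≤ RingHom.ker (phi K m o h) := by
  unfold J
  rw [Ideal.span_le]
  rintro p ⟨r, hr, rfl⟩
  exact phi_det K m o h r (col o h) id Function.injective_id (fun _ => rfl)

theorem aux_field {F : Type*} [Field F] (a b v : F) (hv : v ≠ 0) :
    -(v * (a * (-b / v))) = a * b := by
  field_simp

/-- elements of the kernel vanish at matrices with a kernel vector -/
theorem ker_vanish (K : Type*) [Field K] (m : ℕ) {n k : ℕ} (o : ℕ) (h : o + k < n)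
    {B : Type*} [CommRing B] [IsDomain B] [Algebra K B] (y : Fin m × Fin n → B)
    (V : Fin (k + 1) → B) (hV : V (Fin.last k) ≠ 0)
    (hy : ∀ r, ∑ c, y (r, col o h c) * V c = 0)
    (f : MvPolynomial (Fin m × Fin n) K) (hf : phi K m o h f = 0) :
    aeval y f = 0 := by
  let F := FractionRing B
  let ι : B →ₐ[K] F := IsScalarTower.toAlgHom K B F
  have hι : Function.Injective ι := IsFractionRing.injective B F
  let ev : MvPolynomial ((Fin m × Fin n) ⊕ Fin k) K →ₐ[K] F :=
    aeval (Sum.elim (fun s => ι (y s))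
      (fun c => - ι (V c.castSucc) / ι (V (Fin.last k))))
  have hV' : ι (V (Fin.last k)) ≠ 0 := by
    rw [Ne, map_eq_zero_iff ι hι]; exact hV
  have key : ev.comp (phi K m o h) = ι.comp (aeval y) := by
    apply MvPolynomial.algHom_ext
    rintro ⟨r, j⟩
    simp only [AlgHom.comp_apply, phi, aeval_X]
    split_ifs with hj
    · have hj' : j = col o h (Fin.last k) := by
        simp only [col, Fin.ext_iff, Fin.val_last]; exact hj
      have h1 := congrArg ι (hy r)
      rw [Fin.sum_univ_castSucc] at h1
      simp only [map_add, map_sum, map_mul, map_zero] at h1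
      simp only [map_sum, map_mul, ev, aeval_X, Sum.elim_inl, Sum.elim_inr]
      rw [hj']
      rw [eq_comm, ← sub_eq_zero, ← mul_right_inj' hV', mul_zero, ← h1]
      rw [mul_sub, Finset.mul_sum, sub_eq_add_neg, ← Finset.sum_neg_distrib, add_comm, mul_comm]
      congr 1
      apply Finset.sum_congr rfl
      intro c _
      exact aux_field _ _ _ hV'
    · simp [ev]
  have h2 := congrArg (fun g => g f) key
  simp only [AlgHom.comp_apply, hf, map_zero] at h2
  exact (map_eq_zero_iff ι hι).mp h2.symm

end AdjMin

namespace AdjMin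

open MvPolynomial

/-- the monomial contains a full diagonal -/
def HasDiag {m n k : ℕ} (o : ℕ) (h : o + k < n) (a : Fin m × Fin n →₀ ℕ) : Prop :=
  ∃ r : Fin (k + 1) → Fin m, StrictMono r ∧ ∀ c, a (r c, col o h c) ≠ 0

/-- the weight used for termination -/
noncomputable def W {m n : ℕ} : (Fin m × Fin n →₀ ℕ) →+ ℕ :=
  (Finsupp.weight (R := ℕ) (fun s : Fin m × Fin n => s.1.val * s.2.val))

theorem col_inj {n k : ℕ} (o : ℕ) (h : o + k < n) : Function.Injective (col o h) := by
  intro a b hab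
  simp only [col, Fin.ext_iff] at *
  omega

noncomputable def Ex {m n k : ℕ} (o : ℕ) (h : o + k < n) (r : Fin (k + 1) → Fin m) :
    Fin m × Fin n →₀ ℕ := ∑ c, Finsupp.single (r c, col o h c) 1

theorem W_Ex {m n k : ℕ} (o : ℕ) (h : o + k < n) (r : Fin (k + 1) → Fin m) :
    W (Ex o h r) = ∑ c, (r c).val * (col o h c).val := by
  simp [W, Ex, map_sum, Finsupp.weight_single]

theorem W_lt {m n k : ℕ} (o : ℕ) (h : o + k < n) (r : Fin (k + 1) → Fin m) (hr : StrictMono r)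
    (π : Equiv.Perm (Fin (k + 1))) (hπ : π ≠ 1) :
    W (Ex o h (fun c => r (π c))) < W (Ex o h r) := by
  rw [W_Ex, W_Ex]
  have hm : Monovary (fun c => (r c).val) (fun c => (col o h c).val) := by
    intro a b hab
    have : a < b := by simp only [col, Fin.lt_def] at *; omega
    exact (hr this).le
  refine (hm.sum_comp_perm_mul_lt_sum_mul_iff (σ := π)).mpr ?_
  intro hmon
  apply hπ
  have hmono : StrictMono π := by
    apply Monotone.strictMono_of_injective _ π.injective
    intro a b hab
    rcases hab.eq_or_lt with rfl | hab
    · exact le_rfl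
    · have := hmon (i := a) (j := b) (by simp only [col, Fin.lt_def] at *; omega)
      exact hr.le_iff_le.mp this
  have : (π : Fin (k + 1) → Fin (k + 1)) = id :=
    (StrictMono.range_inj hmono strictMono_id).mp (by
      rw [π.surjective.range_eq, Set.range_id])
  ext c
  simp [this]

theorem Ex_le {m n k : ℕ} (o : ℕ) (h : o + k < n) (r : Fin (k + 1) → Fin m)
    (a : Fin m × Fin n →₀ ℕ) (ha : ∀ c, a (r c, col o h c) ≠ 0) : Ex o h r ≤ a := by
  intro s
  simp only [Ex, Finsupp.coe_finsetSum, Finset.sum_apply, Finsupp.single_apply]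
  by_cases hs : ∃ c, (r c, col o h c) = s
  · obtain ⟨c, rfl⟩ := hs
    rw [Finset.sum_eq_single c]
    · have := ha c
      simp only [if_true]
      omega
    · intro b _ hb
      rw [if_neg]
      intro he
      exact hb (col_inj o h (Prod.ext_iff.mp he).2)
    · simp
  · push Not at hs
    simp [hs]

theorem monomial_Ex (K : Type*) [Field K] {m n k : ℕ} (o : ℕ) (h : o + k < n)
    (r : Fin (k + 1) → Fin m) :
    (∏ c, X (r c, col o h c) : MvPolynomial (Fin m × Fin n) K) = monomial (Ex o h r) 1 := by
  rw [Ex, monomial_sum_one]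
  rfl

theorem reduce (K : Type*) [Field K] (m : ℕ) {n k : ℕ} (o : ℕ) (h : o + k < n) :
    ∀ (N : ℕ) (a : Fin m × Fin n →₀ ℕ), W a = N →
      (monomial a (1 : K)) ∈ (J K m o h).restrictScalars K ⊔
        restrictSupport K {b | ¬ HasDiag o h b} := by
  intro N
  induction N using Nat.strong_induction_on with
  | _ N ih =>
  intro a ha
  by_cases hd : HasDiag o h a
  · obtain ⟨r, hr, hra⟩ := hd
    obtain ⟨a', rfl⟩ := exists_add_of_le (Ex_le o h r a hra)
    have hdet : (Matrix.det (Matrix.of fun a b => X (r a, col o h b)) :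
        MvPolynomial (Fin m × Fin n) K) =
        ∑ π : Equiv.Perm (Fin (k + 1)), Equiv.Perm.sign π •
          monomial (Ex o h (fun c => r (π c))) (1 : K) := by
      rw [Matrix.det_apply]
      simp only [Matrix.of_apply]
      apply Finset.sum_congr rfl
      intro π _
      rw [← monomial_Ex]
    rw [← Finset.add_sum_erase _ _ (Finset.mem_univ 1)] at hdet
    have h1 : monomial (Ex o h r + a') (1 : K) =
        monomial a' 1 * Matrix.det (Matrix.of fun a b => X (r a, col o h b)) -
        ∑ π ∈ (Finset.univ : Finset (Equiv.Perm (Fin (k + 1)))).erase 1,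
          Equiv.Perm.sign π • monomial (Ex o h (fun c => r (π c)) + a') (1 : K) := by
      rw [hdet, mul_add, Finset.mul_sum, add_sub_assoc, ← Finset.sum_sub_distrib]
      rw [Finset.sum_eq_zero]
      · simp [monomial_mul, add_comm]
      · intro π _
        rw [mul_smul_comm, monomial_mul, mul_one, add_comm a', sub_self]
    rw [h1]
    apply Submodule.sub_mem
    · apply Submodule.mem_sup_left
      rw [Submodule.restrictScalars_mem]
      apply Ideal.mul_mem_left
      exact Ideal.subset_span ⟨r, hr, rfl⟩
    · apply Submodule.sum_mem
      intro π hπ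
      have h2 : monomial (Ex o h (fun c => r (π c)) + a') (1 : K) ∈
          (J K m o h).restrictScalars K ⊔ restrictSupport K {b | ¬ HasDiag o h b} := by
        apply ih _ _ _ rfl
        rw [← ha, map_add, map_add]
        have := W_lt o h r hr π (Finset.ne_of_mem_erase hπ)
        omega
      rcases Int.units_eq_one_or (Equiv.Perm.sign π) with hs | hs
      · rw [hs, one_smul]; exact h2
      · rw [hs, Units.neg_smul, one_smul]; exact Submodule.neg_mem _ h2
  · apply Submodule.mem_sup_right
    rw [monomial_mem_restrictSupport]
    exact Or.inl hd

theorem reduce_all (K : Type*) [Field K] (m : ℕ) {n k : ℕ} (o : ℕ) (h : o + k < n)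
    (f : MvPolynomial (Fin m × Fin n) K) :
    ∃ g, (∀ b ∈ g.support, ¬ HasDiag o h b) ∧ f - g ∈ J K m o h := by
  have hf : f ∈ (J K m o h).restrictScalars K ⊔ restrictSupport K {b | ¬ HasDiag o h b} := by
    rw [f.as_sum]
    apply Submodule.sum_mem
    intro a _
    have : monomial a (coeff a f) = coeff a f • monomial a (1 : K) := by
      rw [smul_monomial, smul_eq_mul, mul_one]
    rw [this]
    exact Submodule.smul_mem _ _ (reduce K m o h _ a rfl)
  obtain ⟨p, hp, g, hg, rfl⟩ := Submodule.mem_sup.mp hf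
  refine ⟨g, ?_, ?_⟩
  · rw [mem_restrictSupport_iff] at hg
    exact fun b hb => hg hb
  · rw [add_sub_cancel_right]; exact hp

end AdjMin

namespace AdjMin

open MvPolynomial

section Greedy

open Classical in
/-- greedy column counter -/
noncomputable def gr (F : ℕ → ℕ → Prop) : ℕ → ℕ
  | 0 => 0
  | r + 1 => if F r (gr F r) then gr F r + 1 else gr F r

theorem gr_succ_pos {F : ℕ → ℕ → Prop} {r : ℕ} (h : F r (gr F r)) :
    gr F (r + 1) = gr F r + 1 := by
  rw [gr, if_pos h]

theorem gr_succ_neg {F : ℕ → ℕ → Prop} {r : ℕ} (h : ¬ F r (gr F r)) :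
    gr F (r + 1) = gr F r := by
  rw [gr, if_neg h]

theorem gr_mono (F : ℕ → ℕ → Prop) : Monotone (gr F) := by
  apply monotone_nat_of_le_succ
  intro r
  by_cases h : F r (gr F r)
  · rw [gr_succ_pos h]; omega
  · rw [gr_succ_neg h]

theorem gr_chain (F : ℕ → ℕ → Prop) (r : ℕ) : ∃ ρ : ℕ → ℕ,
    (∀ c < gr F r, F (ρ c) c ∧ ρ c < r) ∧ (∀ c d, c < d → d < gr F r → ρ c < ρ d) := by
  induction r with
  | zero => exact ⟨id, by simp [gr], by simp [gr]⟩
  | succ r ih =>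
    obtain ⟨ρ, h1, h2⟩ := ih
    by_cases h : F r (gr F r)
    · rw [gr_succ_pos h]
      refine ⟨Function.update ρ (gr F r) r, ?_, ?_⟩
      · intro c hc
        by_cases hcg : c = gr F r
        · subst hcg; simp [h]
        · rw [Function.update_of_ne hcg]
          have := h1 c (by omega)
          exact ⟨this.1, by omega⟩
      · intro c d hcd hd
        rw [Function.update_of_ne (by omega : c ≠ gr F r)]
        by_cases hdg : d = gr F r
        · subst hdg
          simp [(h1 c hcd).2]
        · rw [Function.update_of_ne hdg]
          exact h2 c d hcd (by omega)
    · rw [gr_succ_neg h]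
      exact ⟨ρ, fun c hc => ⟨(h1 c hc).1, by have := (h1 c hc).2; omega⟩, h2⟩

theorem gr_pivot_inj {F : ℕ → ℕ → Prop} {r s : ℕ} (hr : F r (gr F r)) (hs : F s (gr F s))
    (h : gr F r = gr F s) : r = s := by
  rcases lt_trichotomy r s with h1 | h1 | h1
  · have := gr_mono F (show r + 1 ≤ s by omega)
    rw [gr_succ_pos hr] at this
    omega
  · exact h1
  · have := gr_mono F (show s + 1 ≤ r by omega)
    rw [gr_succ_pos hs] at this
    omega

/-- exponent of the kernel vector -/
noncomputable def eps (F : ℕ → ℕ → Prop) (m c : ℕ) : ℕ :=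
  ∑ r ∈ Finset.range m, (gr F (r + 1) - c)

noncomputable def T (F : ℕ → ℕ → Prop) (m r c : ℕ) : ℕ := (m - r) * c + eps F m c

theorem T_eq (F : ℕ → ℕ → Prop) (m r c : ℕ) (hr : r < m) :
    T F m r c = ∑ i ∈ Finset.range m, ((if r ≤ i then c else 0) + (gr F (i + 1) - c)) := by
  rw [Finset.sum_add_distrib, T, eps]
  congr 1
  rw [← Finset.sum_filter, Finset.sum_const, smul_eq_mul]
  congr 1
  have : (Finset.range m).filter (fun i => r ≤ i) = Finset.Ico r m := by
    ext i; simp; omega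
  rw [this, Nat.card_Ico]

theorem T_term (F : ℕ → ℕ → Prop) (r c i : ℕ) :
    (if r ≤ i then gr F r else 0) + (gr F (i + 1) - gr F r) ≤
    (if r ≤ i then c else 0) + (gr F (i + 1) - c) := by
  split_ifs with h
  · have := gr_mono F (show r ≤ i + 1 by omega)
    omega
  · have := gr_mono F (show i + 1 ≤ r by omega)
    omega

theorem T_le (F : ℕ → ℕ → Prop) (m r c : ℕ) (hr : r < m) : T F m r (gr F r) ≤ T F m r c := by
  rw [T_eq _ _ _ _ hr, T_eq _ _ _ _ hr]
  exact Finset.sum_le_sum fun i _ => T_term F r c i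

theorem T_lt (F : ℕ → ℕ → Prop) (m r c : ℕ) (hr : r < m) (h1 : c ≠ gr F r)
    (h2 : F r (gr F r) → c ≠ gr F r + 1) : T F m r (gr F r) < T F m r c := by
  rw [T_eq _ _ _ _ hr, T_eq _ _ _ _ hr]
  apply Finset.sum_lt_sum fun i _ => T_term F r c i
  rcases Nat.lt_or_gt_of_ne h1 with h | h
  · have h0 : r ≠ 0 := by rintro rfl; simp [gr] at h
    obtain ⟨q, rfl⟩ := Nat.exists_eq_succ_of_ne_zero h0
    refine ⟨q, by simp; omega, ?_⟩
    simp
    exact h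
  · refine ⟨r, by simpa using hr, ?_⟩
    simp only [le_refl, if_true]
    by_cases hp : F r (gr F r)
    · have := h2 hp
      rw [gr_succ_pos hp]; omega
    · rw [gr_succ_neg hp]; omega

theorem T_pivot (F : ℕ → ℕ → Prop) (m r : ℕ) (hr : r < m) (hp : F r (gr F r)) :
    T F m r (gr F r + 1) = T F m r (gr F r) := by
  rw [T_eq _ _ _ _ hr, T_eq _ _ _ _ hr]
  apply Finset.sum_congr rfl
  intro i _
  split_ifs with h
  · have := gr_mono F (show r + 1 ≤ i + 1 by omega)
    rw [gr_succ_pos hp] at this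
    omega
  · have := gr_mono F (show i + 1 ≤ r by omega)
    omega

end Greedy

/-- support predicate of an exponent vector, in natural-number indices -/
def Fs {m n k : ℕ} (o : ℕ) (h : o + k < n) (a : Fin m × Fin n →₀ ℕ) (r c : ℕ) : Prop :=
  ∃ (hr : r < m) (hc : c < k + 1), a (⟨r, hr⟩, col o h ⟨c, hc⟩) ≠ 0

theorem gr_le {m n k : ℕ} (o : ℕ) (h : o + k < n) (a : Fin m × Fin n →₀ ℕ)
    (ha : ¬ HasDiag o h a) : gr (Fs o h a) m ≤ k := by
  by_contra hcon
  push Not at hcon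
  apply ha
  obtain ⟨ρ, h1, h2⟩ := gr_chain (Fs o h a) m
  refine ⟨fun c => ⟨ρ c, (h1 c (by omega)).2⟩, ?_, ?_⟩
  · intro c d hcd
    exact h2 c d hcd (by omega)
  · intro c
    obtain ⟨_, _, h3⟩ := (h1 c (by omega)).1
    exact h3

section Point

variable {K : Type*} [Field K] {m n k : ℕ} (o : ℕ) (h : o + k < n)
  {L : Type*} [Field L] [Algebra K L] (x : Fin m × Fin n → L) (F : ℕ → ℕ → Prop)

noncomputable def xn (r : Fin m) (c : ℕ) : L :=
  if hc : c < k + 1 then x (r, col o h ⟨c, hc⟩) else 1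

open Classical in
noncomputable def uu (c : ℕ) : L :=
  ∏ r : Fin m, if F r (gr F r) ∧ gr F r < c then
    - xn o h x r (gr F r) / xn o h x r (gr F r + 1) else 1

theorem xn_ne (hx : ∀ s, x s ≠ 0) (r : Fin m) (c : ℕ) : xn o h x r c ≠ 0 := by
  unfold xn
  split_ifs
  · exact hx _
  · exact one_ne_zero

theorem uu_ne (hx : ∀ s, x s ≠ 0) (c : ℕ) : uu o h x F c ≠ 0 := by
  unfold uu
  rw [Finset.prod_ne_zero_iff]
  intro r _
  split_ifs
  · exact div_ne_zero (neg_ne_zero.mpr (xn_ne o h x hx _ _)) (xn_ne o h x hx _ _)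
  · exact one_ne_zero

theorem uu_succ (r : Fin m) (hr : F r (gr F r)) :
    uu o h x F (gr F r + 1) =
      uu o h x F (gr F r) * (- xn o h x r (gr F r) / xn o h x r (gr F r + 1)) := by
  classical
  have h1 : (- xn o h x r (gr F r) / xn o h x r (gr F r + 1)) =
    ∏ s : Fin m, if s = r then - xn o h x s (gr F s) / xn o h x s (gr F s + 1) else 1 := by
    rw [Finset.prod_ite_eq' Finset.univ r
      (fun s : Fin m => - xn o h x s (gr F s) / xn o h x s (gr F s + 1))]
    simp
  rw [h1]
  unfold uu
  rw [← Finset.prod_mul_distrib]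
  apply Finset.prod_congr rfl
  intro s _
  by_cases hsr : s = r
  · subst hsr
    simp [hr]
  · rw [if_neg hsr, mul_one]
    by_cases hs : F s (gr F s)
    · have : gr F s ≠ gr F r := fun he => hsr (Fin.ext (gr_pivot_inj hs hr he))
      have : gr F s < gr F r + 1 ↔ gr F s < gr F r := by omega
      simp only [this]
    · simp [hs]

open Classical in
noncomputable def zz (s : Fin m × Fin n) : Polynomial L :=
  if s.2.val = o + gr F s.1 then
    - ∑ c ∈ (Finset.univ : Finset (Fin (k + 1))).filter (fun c => c.val ≠ gr F s.1),
      Polynomial.C (x (s.1, col o h c) * uu o h x F c / uu o h x F (gr F s.1)) *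
        Polynomial.X ^ (T F m s.1 c - T F m s.1 (gr F s.1))
  else Polynomial.C (x s)

noncomputable def yy (s : Fin m × Fin n) : Polynomial L :=
  Polynomial.X ^ ((m - s.1.val) * s.2.val) * zz o h x F s

noncomputable def VV (c : Fin (k + 1)) : Polynomial L :=
  Polynomial.C (uu o h x F c) * Polynomial.X ^ (eps F m c)

theorem VV_ne (hx : ∀ s, x s ≠ 0) (c : Fin (k + 1)) : VV o h x F c ≠ 0 := by
  unfold VV
  exact mul_ne_zero (Polynomial.C_ne_zero.mpr (uu_ne o h x F hx _))
    (pow_ne_zero _ Polynomial.X_ne_zero)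

theorem yy_row (hx : ∀ s, x s ≠ 0) (hF : gr F m ≤ k) (r : Fin m) :
    ∑ c, yy o h x F (r, col o h c) * VV o h x F c = 0 := by
  classical
  have hg : gr F r < k + 1 := by
    have := gr_mono F r.isLt.le
    omega
  have e1 : ∀ c : Fin (k + 1), yy o h x F (r, col o h c) * VV o h x F c =
      Polynomial.X ^ ((m - r.val) * o) *
        (zz o h x F (r, col o h c) * (Polynomial.C (uu o h x F c) * Polynomial.X ^ (T F m r c))) := by
    intro c
    simp only [yy, VV, T, col]
    rw [mul_add, pow_add, pow_add]
    ring
  simp only [e1]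
  rw [← Finset.mul_sum]
  apply mul_eq_zero_of_right
  rw [← Finset.sum_filter_add_sum_filter_not Finset.univ (fun c : Fin (k + 1) => c.val ≠ gr F r)]
  have e2 : (Finset.univ : Finset (Fin (k + 1))).filter (fun c => ¬ c.val ≠ gr F r) =
      {⟨gr F r, hg⟩} := by
    ext c; simp [Fin.ext_iff]
  rw [e2, Finset.sum_singleton]
  have e3 : zz o h x F (r, col o h ⟨gr F r, hg⟩) =
    - ∑ c ∈ (Finset.univ : Finset (Fin (k + 1))).filter (fun c => c.val ≠ gr F r),
      Polynomial.C (x (r, col o h c) * uu o h x F c / uu o h x F (gr F r)) *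
        Polynomial.X ^ (T F m r c - T F m r (gr F r)) := by
    unfold zz
    rw [if_pos (by simp [col])]
  rw [e3, neg_mul, Finset.sum_mul, ← sub_eq_add_neg, ← Finset.sum_sub_distrib]
  apply Finset.sum_eq_zero
  intro c hc
  rw [Finset.mem_filter] at hc
  have e4 : zz o h x F (r, col o h c) = Polynomial.C (x (r, col o h c)) := by
    unfold zz
    rw [if_neg]
    have := hc.2
    simp only [col]
    omega
  have e5 : T F m r c = (T F m r c - T F m r (gr F r)) + T F m r (gr F r) := by
    have := T_le F m r c r.isLt
    omega
  rw [e4]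
  nth_rw 1 [e5]
  rw [pow_add, sub_eq_zero]
  have e6 : Polynomial.C (x (r, col o h c) * uu o h x F c / uu o h x F (gr F r)) *
      Polynomial.C (uu o h x F (gr F r)) =
      Polynomial.C (x (r, col o h c)) * Polynomial.C (uu o h x F c) := by
    rw [← map_mul, ← map_mul, div_mul_cancel₀ _ (uu_ne o h x F hx _)]
  linear_combination (-(Polynomial.X ^ (T F m r c - T F m r (gr F r)) *
    Polynomial.X ^ T F m r (gr F r))) * e6

open Classical in
theorem zz_eval (hx : ∀ s, x s ≠ 0) (hF : gr F m ≤ k) (s : Fin m × Fin n) :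
    (zz o h x F s).eval 0 =
      if s.2.val = o + gr F s.1 ∧ ¬ F s.1 (gr F s.1) then 0 else x s := by
  obtain ⟨r, j⟩ := s
  by_cases hj : j.val = o + gr F r
  · have hg : gr F r < k + 1 := by
      have := gr_mono F r.isLt.le
      omega
    have hz : zz o h x F (r, j) = - ∑ c ∈ (Finset.univ : Finset (Fin (k + 1))).filter
        (fun c => c.val ≠ gr F r),
      Polynomial.C (x (r, col o h c) * uu o h x F c / uu o h x F (gr F r)) *
        Polynomial.X ^ (T F m r c - T F m r (gr F r)) := by
      unfold zz
      rw [if_pos hj]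
    rw [hz]
    simp only [Polynomial.eval_neg, Polynomial.eval_finsetSum, Polynomial.eval_mul,
      Polynomial.eval_C, Polynomial.eval_pow, Polynomial.eval_X]
    by_cases hp : F r (gr F r)
    · rw [if_neg (by simp [hp])]
      have hg1 : gr F r + 1 < k + 1 := by
        have := gr_mono F (show r.val + 1 ≤ m from r.isLt)
        rw [gr_succ_pos hp] at this
        omega
      rw [Finset.sum_eq_single ⟨gr F r + 1, hg1⟩]
      · simp only [T_pivot F m r r.isLt hp, Nat.sub_self, pow_zero, mul_one]
        rw [uu_succ o h x F r hp]
        have hxj : x (r, j) = xn o h x r (gr F r) := by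
          unfold xn
          rw [dif_pos hg]
          congr 2
          exact Fin.ext hj
        have hx1 : x (r, col o h ⟨gr F r + 1, hg1⟩) = xn o h x r (gr F r + 1) := by
          unfold xn
          rw [dif_pos hg1]
        rw [hxj, hx1]
        have n1 := xn_ne o h x hx r (gr F r + 1)
        have n2 := uu_ne o h x F hx (gr F r)
        field_simp
      · intro c hc hne
        rw [Finset.mem_filter] at hc
        have := T_lt F m r c r.isLt hc.2 (fun _ he => hne (Fin.ext he))
        rw [zero_pow (by omega), mul_zero]
      · intro hc
        simp at hc
    · rw [if_pos ⟨hj, hp⟩]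
      rw [neg_eq_zero]
      apply Finset.sum_eq_zero
      intro c hc
      rw [Finset.mem_filter] at hc
      have := T_lt F m r c r.isLt hc.2 (fun h' => absurd h' hp)
      rw [zero_pow (by omega), mul_zero]
  · have hz : zz o h x F (r, j) = Polynomial.C (x (r, j)) := by
      unfold zz
      rw [if_neg hj]
    rw [hz, if_neg (fun hh => hj hh.1), Polynomial.eval_C]

end Point

end AdjMin

namespace AdjMin

open MvPolynomial

/-- the second weight -/
noncomputable def W2 {m n : ℕ} (b : Fin m × Fin n →₀ ℕ) : ℕ :=
  ∑ s : Fin m × Fin n, ((m - s.1.val) * s.2.val) * b s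

theorem prod_zero_or {σ K : Type*} [Fintype σ] [Field K] (P : σ → Prop) [DecidablePred P]
    (b : σ →₀ ℕ) :
    (∏ s, (if P s then (0 : MvPolynomial σ K) else X s) ^ b s) =
      if ∀ s, P s → b s = 0 then monomial b 1 else 0 := by
  split_ifs with hb
  · rw [monomial_eq, map_one, one_mul, Finsupp.prod_fintype _ _ (by simp)]
    apply Finset.prod_congr rfl
    intro s _
    split_ifs with hs
    · rw [hb s hs, pow_zero, pow_zero]
    · rfl
  · push Not at hb
    obtain ⟨s, hs, hbs⟩ := hb
    apply Finset.prod_eq_zero (Finset.mem_univ s)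
    rw [if_pos hs, zero_pow hbs]

theorem reduced_eq_zero (K : Type*) [Field K] (m : ℕ) {n k : ℕ} (o : ℕ) (h : o + k < n)
    {L : Type*} [Field L] [Algebra K L] (x : Fin m × Fin n → L)
    (hx : AlgebraicIndependent K x)
    (f : MvPolynomial (Fin m × Fin n) K) (hf : phi K m o h f = 0)
    (hred : ∀ b ∈ f.support, ¬ HasDiag o h b) : f = 0 := by
  classical
  by_contra hne
  obtain ⟨a, ha, hmin⟩ := Finset.exists_min_image f.support W2 (support_nonempty.mpr hne)
  have hx0 : ∀ s, x s ≠ 0 := fun s => hx.ne_zero s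
  set F := Fs o h a with hFdef
  have hF : gr F m ≤ k := gr_le o h a (hred a ha)
  have h0 : aeval (yy o h x F) f = 0 :=
    ker_vanish K m o h (yy o h x F) (VV o h x F) (VV_ne o h x F hx0 _)
      (yy_row o h x F hx0 hF) f hf
  rw [aeval_def, eval₂_eq'] at h0
  have h1 : ∀ b ∈ f.support, (algebraMap K (Polynomial L)) (coeff b f) *
      ∏ s, yy o h x F s ^ b s = Polynomial.X ^ W2 a *
      (Polynomial.C (algebraMap K L (coeff b f)) * (Polynomial.X ^ (W2 b - W2 a) *
        ∏ s, zz o h x F s ^ b s)) := by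
    intro b hb
    have h2 : ∏ s, yy o h x F s ^ b s = Polynomial.X ^ W2 b * ∏ s, zz o h x F s ^ b s := by
      simp only [yy, mul_pow, ← pow_mul]
      rw [Finset.prod_mul_distrib, Finset.prod_pow_eq_pow_sum, W2]
    have h3 : W2 b = W2 a + (W2 b - W2 a) := by have := hmin b hb; omega
    rw [h2]
    nth_rw 1 [h3]
    rw [pow_add, Polynomial.algebraMap_apply]
    ring
  rw [Finset.sum_congr rfl h1, ← Finset.mul_sum] at h0
  have h4 := (mul_eq_zero.mp h0).resolve_left (pow_ne_zero _ Polynomial.X_ne_zero)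
  have h5 := congrArg (Polynomial.eval 0) h4
  simp only [Polynomial.eval_finsetSum, Polynomial.eval_mul, Polynomial.eval_C,
    Polynomial.eval_pow, Polynomial.eval_X, Polynomial.eval_prod, zz_eval o h x F hx0 hF,
    Polynomial.eval_zero] at h5
  have h6 : aeval x (∑ b ∈ f.support, C (coeff b f) * ((0 : MvPolynomial _ K) ^ (W2 b - W2 a) *
      ∏ s : Fin m × Fin n,
        (if s.2.val = o + gr F s.1 ∧ ¬ F s.1 (gr F s.1) then (0 : MvPolynomial _ K)
          else X s) ^ b s)) = 0 := by
    rw [← h5, map_sum]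
    apply Finset.sum_congr rfl
    intro b _
    simp only [map_mul, map_pow, map_prod, map_zero, aeval_C, apply_ite (aeval x), aeval_X]
  have h7 := (map_eq_zero_iff _ hx).mp h6
  have h8 := congrArg (coeff a) h7
  rw [coeff_sum, coeff_zero, Finset.sum_eq_single a] at h8
  · rw [prod_zero_or, if_pos] at h8
    · rw [Nat.sub_self, pow_zero, one_mul, coeff_C_mul, coeff_monomial, if_pos rfl, mul_one] at h8
      exact (mem_support_iff.mp ha) h8
    · rintro ⟨r, j⟩ ⟨hj, hp⟩
      by_contra hne'
      apply hp
      have hg : gr F r < k + 1 := by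
        have := gr_mono F r.isLt.le
        omega
      refine ⟨r.isLt, hg, ?_⟩
      have : col o h ⟨gr F r, hg⟩ = j := Fin.ext hj.symm
      rw [this]
      exact hne'
  · intro b _ hb
    rw [prod_zero_or]
    rw [coeff_C_mul]
    apply mul_eq_zero_of_right
    split_ifs with hc
    · rcases Nat.eq_zero_or_pos (W2 b - W2 a) with he | he
      · rw [he, pow_zero, one_mul, coeff_monomial, if_neg hb]
      · rw [zero_pow (by omega), zero_mul, coeff_zero]
    · rw [mul_zero, coeff_zero]
  · intro h'
    exact absurd ha h'

theorem J_eq_ker (K : Type*) [Field K] (m : ℕ) {n k : ℕ} (o : ℕ) (h : o + k < n) :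
    J K m o h = RingHom.ker (phi K m o h) := by
  apply le_antisymm (J_le_ker K m o h)
  intro f hf
  obtain ⟨g, hg, hfg⟩ := reduce_all K m o h f
  have h1 := J_le_ker K m o h hfg
  rw [RingHom.mem_ker] at hf h1
  rw [map_sub, hf, zero_sub, neg_eq_zero] at h1
  let S := MvPolynomial (Fin m × Fin n) K
  let L := FractionRing S
  have hx : AlgebraicIndependent K (fun s => algebraMap S L (X s)) := by
    have he : (aeval (fun s => algebraMap S L (X s)) : S →ₐ[K] L) =
        IsScalarTower.toAlgHom K S L := by
      apply MvPolynomial.algHom_ext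
      intro s
      rw [aeval_X]
      rfl
    unfold AlgebraicIndependent
    rw [he]
    exact IsFractionRing.injective S L
  have h2 := reduced_eq_zero K m o h _ hx g h1 hg
  rw [h2, sub_zero] at hfg
  exact hfg

theorem J_prime (K : Type*) [Field K] (m : ℕ) {n k : ℕ} (o : ℕ) (h : o + k < n) :
    (J K m o h).IsPrime := by
  rw [J_eq_ker]
  exact RingHom.ker_isPrime _

end AdjMin

namespace AdjMin

open MvPolynomial

section Minimal

variable (K : Type*) [Field K] {m n k d o : ℕ}

/-- columns of the `s`-th window -/
def win (hon : o + m ≤ n) (s : Fin (d + 1)) (b : Fin m) : Fin n := ⟨o - s.val + b.val, by omega⟩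

noncomputable def MM (hon : o + m ≤ n) (s : Fin (d + 1)) :
    Matrix (Fin m) (Fin m) (MvPolynomial (Fin m × Fin n) K) :=
  Matrix.of fun a b => X (a, win hon s b)

/-- position of the last column of the small window inside the `s`-th window -/
def bs (hm : m = k + 1 + d) (s : Fin (d + 1)) : Fin m := ⟨s.val + k, by omega⟩

noncomputable def Phi (hm : m = k + 1 + d) (hon : o + m ≤ n) :
    Matrix (Fin (d + 1)) (Fin m) (MvPolynomial (Fin m × Fin n) K) :=
  Matrix.of fun s r => (MM K hon s).adjugate (bs hm s) r

def rr (hm : m = k + 1 + d) (s : Fin (d + 1)) : Fin m := ⟨k + s.val, by omega⟩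

/-- which standard basis vector a column is sent to at the special point -/
def kap (m k o j : ℕ) : ℕ :=
  if j < o then k + (o - j) - 1
  else if j < o + k then j - o
  else if j = o + k then m
  else m - (j - (o + k))

noncomputable def pt (K : Type*) [Field K] {m n : ℕ} (k o : ℕ) (s : Fin m × Fin n) : K :=
  if s.1.val = kap m k o s.2.val then 1 else 0

theorem pt_J (h : o + k < n) (f : MvPolynomial (Fin m × Fin n) K) (hf : f ∈ J K m o h) :
    eval (pt K k o) f = 0 := by
  have : J K m o h ≤ RingHom.ker (eval (pt K k o)) := by
    unfold J
    rw [Ideal.span_le]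
    rintro p ⟨r, -, rfl⟩
    rw [SetLike.mem_coe, RingHom.mem_ker, RingHom.map_det]
    apply Matrix.det_eq_zero_of_column_eq_zero (Fin.last k)
    intro a
    have := (r a).isLt
    simp only [RingHom.mapMatrix_apply, Matrix.map_apply, Matrix.of_apply, eval_X, pt, col, kap,
      Fin.val_last]
    rw [if_neg]
    rw [if_neg (by omega), if_neg (by omega), if_pos trivial]
    omega
  exact this hf

theorem pt_MM (hon : o + m ≤ n) (s : Fin (d + 1)) (a b : Fin m) :
    (eval (pt K k o)).mapMatrix (MM K hon s) a b =
      if a.val = kap m k o (o - s.val + b.val) then 1 else 0 := by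
  simp [MM, pt, win]

theorem Phi_diag (hm : m = k + 1 + d) (hdo : d ≤ o) (hon : o + m ≤ n)
    (s : Fin (d + 1)) :
    eval (pt K k o) (Phi K hm hon s (rr hm s)) ≠ 0 := by
  have h1 : eval (pt K k o) (Phi K hm hon s (rr hm s)) =
      ((eval (pt K k o)).mapMatrix (MM K hon s)).adjugate (bs hm s) (rr hm s) := by
    rw [← RingHom.map_adjugate]; rfl
  rw [h1, Matrix.adjugate_apply]
  have hs := s.isLt
  let π : Fin m → Fin m := fun b =>
    ⟨if b.val = s.val + k then k + s.val else kap m k o (o - s.val + b.val), by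
      have := b.isLt
      unfold kap
      split_ifs <;> omega⟩
  have hπ : Function.Injective π := by
    intro b c hbc
    have h2 := b.isLt
    have h3 := c.isLt
    simp only [π, Fin.mk.injEq, kap] at hbc
    apply Fin.ext
    split_ifs at hbc <;> omega
  let e : Equiv.Perm (Fin m) := Equiv.ofBijective π (Finite.injective_iff_bijective.mp hπ)
  have h4 : ((eval (pt K k o)).mapMatrix (MM K hon s)).updateRow (rr hm s)
      (Pi.single (bs hm s) 1) = (1 : Matrix (Fin m) (Fin m) K).submatrix id e := by
    ext a b
    have h2 := b.isLt
    have h3 := a.isLt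
    rw [Matrix.updateRow_apply, Matrix.submatrix_apply, Matrix.one_apply, pt_MM, Pi.single_apply]
    have he : (id a = e b) ↔
        a.val = if b.val = s.val + k then k + s.val else kap m k o (o - s.val + b.val) := by
      simp [e, π, Fin.ext_iff]
    simp only [he, bs, rr, Fin.ext_iff, kap]
    split_ifs <;> first | rfl | omega
  rw [h4, Matrix.det_permute', Matrix.det_one, mul_one]
  rcases Int.units_eq_one_or (Equiv.Perm.sign e) with hs | hs <;> simp [hs]

theorem Phi_off (hm : m = k + 1 + d) (hdo : d ≤ o) (hon : o + m ≤ n)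
    (s j : Fin (d + 1)) (hsj : s ≠ j) :
    eval (pt K k o) (Phi K hm hon s (rr hm j)) = 0 := by
  set A := (eval (pt K k o)).mapMatrix (MM K hon s) with hA
  have h1 : eval (pt K k o) (Phi K hm hon s (rr hm j)) = A.adjugate (bs hm s) (rr hm j) := by
    rw [hA, ← RingHom.map_adjugate]; rfl
  rw [h1]
  have hs := s.isLt
  have hj := j.isLt
  have hsj' : s.val ≠ j.val := fun h => hsj (Fin.ext h)
  -- the column of the window that is sent to the basis vector `rr j`
  obtain ⟨b, hb, hbk⟩ : ∃ b : Fin m, b.val ≠ s.val + k ∧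
      kap m k o (o - s.val + b.val) = k + j.val := by
    rcases Nat.lt_or_gt_of_ne hsj' with h | h
    · refine ⟨⟨s.val + m - j.val, by omega⟩, by simp only; omega, ?_⟩
      unfold kap
      simp only
      split_ifs <;> omega
    · refine ⟨⟨s.val - j.val - 1, by omega⟩, by simp only; omega, ?_⟩
      unfold kap
      simp only
      split_ifs <;> omega
  have h2 := congrFun (congrFun (Matrix.adjugate_mul A) (bs hm s)) b
  have hne : bs hm s ≠ b := by
    intro he
    apply hb
    rw [← he]
    rfl
  rw [Matrix.mul_apply, Matrix.smul_apply, Matrix.one_apply_ne hne, smul_zero,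
    Finset.sum_eq_single (rr hm j)] at h2
  · rw [hA, pt_MM, hbk, if_pos (show (rr hm j).val = k + j.val from rfl), mul_one] at h2
    exact h2
  · intro r _ hr
    rw [hA, pt_MM, hbk, if_neg, mul_zero]
    intro he
    exact hr (Fin.ext he)
  · simp

theorem minor_not_mem (hm : m = k + 1 + d) (hdo : d ≤ o) (hon : o + m ≤ n)
    (h : o + k < n) :
    ((Phi K hm hon).submatrix id (rr hm)).det ∉ J K m o h := by
  intro hmem
  have h1 := pt_J K h _ hmem
  rw [RingHom.map_det] at h1
  have h2 : (eval (pt K k o)).mapMatrix ((Phi K hm hon).submatrix id (rr hm)) =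
      Matrix.diagonal (fun s => eval (pt K k o) (Phi K hm hon s (rr hm s))) := by
    ext s j
    rw [Matrix.diagonal_apply]
    split_ifs with hsj
    · subst hsj; rfl
    · exact Phi_off K hm hdo hon s j hsj
  rw [h2, Matrix.det_diagonal, Finset.prod_eq_zero_iff] at h1
  obtain ⟨s, -, hs⟩ := h1
  exact Phi_diag K hm hdo hon s hs

theorem J_le_of (hm : m = k + 1 + d) (hdo : d ≤ o) (hon : o + m ≤ n)
    (h : o + k < n) (Q : Ideal (MvPolynomial (Fin m × Fin n) K)) [hQ : Q.IsPrime]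
    (hQJ : Q ≤ J K m o h) (hdet : ∀ s : Fin (d + 1), (MM K hon s).det ∈ Q) : J K m o h ≤ Q := by
  let S := MvPolynomial (Fin m × Fin n) K
  let L := FractionRing (S ⧸ Q)
  let θ : S →+* L := (algebraMap (S ⧸ Q) L).comp (Ideal.Quotient.mk Q)
  have hθ : ∀ f, θ f = 0 ↔ f ∈ Q := by
    intro f
    rw [← Ideal.Quotient.eq_zero_iff_mem]
    exact map_eq_zero_iff _ (IsFractionRing.injective (S ⧸ Q) L)
  let Y : Matrix (Fin m) (Fin (k + 1)) S := Matrix.of fun a c => X (a, col o h c)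
  have hmul : (Phi K hm hon).map θ * Y.map θ = 0 := by
    rw [← Matrix.map_mul]
    ext s c
    rw [Matrix.map_apply, Matrix.zero_apply, hθ]
    have hs := s.isLt
    have hc := c.isLt
    have h2 := congrFun (congrFun (Matrix.adjugate_mul (MM K hon s)) (bs hm s))
      ⟨s.val + c.val, by omega⟩
    have h3 : (Phi K hm hon * Y) s c = ((MM K hon s).adjugate * MM K hon s) (bs hm s)
        ⟨s.val + c.val, by omega⟩ := by
      rw [Matrix.mul_apply, Matrix.mul_apply]
      apply Finset.sum_congr rfl
      intro r _
      have : col o h c = win hon s ⟨s.val + c.val, by omega⟩ := by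
        apply Fin.ext
        simp only [col, win]
        omega
      simp only [Phi, Y, MM, Matrix.of_apply, this]
    rw [h3, h2, Matrix.smul_apply, smul_eq_mul]
    exact Ideal.mul_mem_right _ _ (hdet s)
  have hrank := Matrix.rank_add_rank_le_card_of_mul_eq_zero hmul
  have hr1 : d + 1 ≤ ((Phi K hm hon).map θ).rank := by
    have h1 : (((Phi K hm hon).map θ).submatrix id (rr hm)).det ≠ 0 := by
      have : ((Phi K hm hon).map θ).submatrix id (rr hm) =
          θ.mapMatrix ((Phi K hm hon).submatrix id (rr hm)) := rfl
      rw [this, ← RingHom.map_det, Ne, hθ]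
      exact fun hmem => minor_not_mem K hm hdo hon h (hQJ hmem)
    have h2 := Matrix.rank_of_isUnit _ ((Matrix.isUnit_iff_isUnit_det _).mpr (Ne.isUnit h1))
    have h3 := Matrix.rank_submatrix_le ((Phi K hm hon).map θ) id (rr hm)
    rw [h2, Fintype.card_fin] at h3
    exact h3
  rw [Fintype.card_fin] at hrank
  unfold J
  rw [Ideal.span_le]
  rintro p ⟨r, -, rfl⟩
  rw [SetLike.mem_coe, ← hθ]
  by_contra hne
  have h1 : ((Y.map θ).submatrix r id).det ≠ 0 := by
    have : (Y.map θ).submatrix r id =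
        θ.mapMatrix (Matrix.of fun a b => X (r a, col o h b)) := rfl
    rw [this, ← RingHom.map_det]
    exact hne
  have h2 := Matrix.rank_of_isUnit _ ((Matrix.isUnit_iff_isUnit_det _).mpr (Ne.isUnit h1))
  have h3 := Matrix.rank_submatrix_le (Y.map θ) r id
  rw [h2, Fintype.card_fin] at h3
  omega

end Minimal

end AdjMin


/-- For `m - t + 1 ≤ i ≤ n - m + 1`, the determinantal ideal `I_t(X_{[i,t+i-1]})` is a
minimal prime of the ideal `H` generated by the `m - t + 1` maximal minors
`det X_{[j, j+m-1]}` for `i + t - m ≤ j ≤ i` (windows of `m` consecutive columns). -/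
theorem adjacent_minors_mem_minimalPrimes (K : Type*) [Field K] (m n : ℕ)
    (hm : 0 < m) (hmn : m < n) (t : ℕ) (ht1 : 1 ≤ t) (htm : t ≤ m)
    (i : ℕ) (hi1 : m - t + 1 ≤ i) (hi2 : i ≤ n - m + 1) :
    genMinors K m n t 1 m i (t + i - 1) ∈
      (Ideal.span { p : MvPolynomial (Fin m × Fin n) K |
        ∃ j : ℕ, ∃ _ : i + t - m ≤ j, ∃ _ : j ≤ i,
          p = Matrix.det (Matrix.of fun (a b : Fin m) =>
            MvPolynomial.X (a, (⟨j - 1 + b.val, by omega⟩ : Fin n))) }).minimalPrimes := by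
  obtain ⟨k, rfl⟩ : ∃ k, t = k + 1 := ⟨t - 1, by omega⟩
  obtain ⟨o, rfl⟩ : ∃ o, i = o + 1 := ⟨i - 1, by omega⟩
  obtain ⟨d, hd⟩ : ∃ d, m = k + 1 + d := ⟨m - (k + 1), by omega⟩
  have h : o + k < n := by omega
  have hon : o + m ≤ n := by omega
  have hdo : d ≤ o := by omega
  rw [AdjMin.genMinors_eq K m o h]
  have hgen : ∀ s : Fin (d + 1), (AdjMin.MM K hon s).det ∈
      (Ideal.span { p : MvPolynomial (Fin m × Fin n) K |
        ∃ j : ℕ, ∃ _ : o + 1 + (k + 1) - m ≤ j, ∃ _ : j ≤ o + 1,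
          p = Matrix.det (Matrix.of fun (a b : Fin m) =>
            MvPolynomial.X (a, (⟨j - 1 + b.val, by omega⟩ : Fin n))) }) := by
    intro s
    have hs := s.isLt
    apply Ideal.subset_span
    refine ⟨o + 1 - s.val, by omega, by omega, ?_⟩
    unfold AdjMin.MM
    congr 2
    funext a b
    congr 2
    apply Fin.ext
    simp only [AdjMin.win]
    omega
  refine ⟨⟨AdjMin.J_prime K m o h, ?_⟩, ?_⟩
  · rw [Ideal.span_le]
    rintro p ⟨j, hj1, hj2, rfl⟩
    rw [SetLike.mem_coe, AdjMin.J_eq_ker, RingHom.mem_ker]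
    refine AdjMin.phi_det K m o h id _ (fun c => ⟨o + 1 - j + c.val, by omega⟩) ?_ ?_
    · intro a b hab
      simp only [Fin.mk.injEq] at hab
      apply Fin.ext
      omega
    · intro c
      apply Fin.ext
      simp only [AdjMin.col]
      omega
  · rintro Q ⟨hQ, hHQ⟩ hQJ
    exact AdjMin.J_le_of K hd hdo hon h Q hQJ (fun s => hHQ (hgen s))
end

section
/- Let K be a field, m < n positive integers, X the m×n generic matrix over S = K[x_{ij}], and t ≤ m. For each i with m−t+1 ≤ i ≤ n−m+1, the ideal H = (det X_{[i,i+m−1]}, det X_{[i−1,i+m−2]}, ..., det X_{[i−m+t,i+t−1]}) of S, generated by m−t+1 maximal minors of X on windows of m consecutive columns, has height equal to m−t+1 (so H is a complete intersection). -/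
open MvPolynomial in
theorem wih_height_vars {K σ : Type*} [Field K] [DecidableEq σ] (T : Finset σ)
    (q : Ideal (MvPolynomial σ K)) [q.IsPrime] (hq : ∀ i ∈ T, (X i : MvPolynomial σ K) ∈ q) :
    (T.card : ℕ∞) ≤ q.height := by
  let kill : Finset σ → (MvPolynomial σ K →ₐ[K] MvPolynomial σ K) := fun T =>
    aeval (fun i => if i ∈ T then 0 else X i)
  have hprime : ∀ T, (RingHom.ker (kill T)).IsPrime := fun T => RingHom.ker_isPrime _
  have key : ∀ T : Finset σ, (T.card : ℕ∞) ≤ (RingHom.ker (kill T)).height := by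
    intro T
    induction T using Finset.induction_on with
    | empty => simp
    | insert a T ha ih =>
      have := hprime T
      have := hprime (insert a T)
      have hlt : RingHom.ker (kill T) < RingHom.ker (kill (insert a T)) := by
        refine lt_of_le_of_ne ?_ ?_
        · intro x hx
          have hc : (kill (insert a T)).comp (kill T) = kill (insert a T) := by
            apply MvPolynomial.algHom_ext
            intro j
            by_cases hj : j ∈ T <;> simp [kill, hj]
          rw [RingHom.mem_ker] at hx ⊢
          rw [← hc, AlgHom.comp_apply, hx, map_zero]
        · intro h
          have h1 : (X a : MvPolynomial σ K) ∈ RingHom.ker (kill (insert a T)) := by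
            simp [RingHom.mem_ker, kill]
          rw [← h] at h1
          simp [RingHom.mem_ker, kill, ha] at h1
      rw [Finset.card_insert_of_notMem ha]
      push_cast
      exact (add_le_add_left ih 1).trans (Ideal.height_add_one_le_of_lt_of_isPrime hlt)
  refine (key T).trans (Ideal.height_mono ?_)
  have hsub : ∀ x, x - kill T x ∈ q := by
    intro x
    rw [← Ideal.Quotient.eq]
    have : (Ideal.Quotient.mkₐ K q) = (Ideal.Quotient.mkₐ K q).comp (kill T) := by
      apply MvPolynomial.algHom_ext
      intro j
      by_cases hj : j ∈ T
      · simpa [kill, hj] using Ideal.Quotient.eq_zero_iff_mem.mpr (hq j hj)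
      · simp [kill, hj]
    exact congrArg (fun f => f x) this
  intro x hx
  have := hsub x
  rw [RingHom.mem_ker] at hx
  rwa [hx, sub_zero] at this

open MvPolynomial in
theorem wih_height_of_integral {K σ : Type*} [Field K] [Finite σ] [DecidableEq σ]
    (g : σ → MvPolynomial σ K)
    (hg : ∀ i, IsIntegral (Algebra.adjoin K (Set.range g)) (X i : MvPolynomial σ K))
    (T : Finset σ) (p : Ideal (MvPolynomial σ K)) [p.IsPrime] (hp : ∀ i ∈ T, g i ∈ p) :
    (T.card : ℕ∞) ≤ p.height := by
  set A := Algebra.adjoin K (Set.range g) with hA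
  have hint : Algebra.IsIntegral A (MvPolynomial σ K) := by
    constructor
    intro x
    induction x using MvPolynomial.induction_on with
    | C a =>
      have : (C a : MvPolynomial σ K) = algebraMap A _ (algebraMap K A a) := rfl
      rw [this]
      exact isIntegral_algebraMap
    | add p q hp hq => exact hp.add hq
    | mul_X p i hp => exact hp.mul (hg i)
  have hb : IsTranscendenceBasis K g := by
    have : Algebra.IsAlgebraic (Algebra.adjoin K (Set.range g)) (MvPolynomial σ K) :=
      inferInstance
    apply Algebra.IsAlgebraic.isTranscendenceBasis_of_lift_le_trdeg_of_finite
    rw [MvPolynomial.trdeg_of_isDomain]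
    simp
  let e : MvPolynomial σ K ≃ₐ[K] A := hb.1.aevalEquiv
  have : IsIntegrallyClosed A := IsIntegrallyClosed.of_equiv e.toRingEquiv
  have : IsNoetherianRing A := isNoetherianRing_of_ringEquiv _ e.toRingEquiv
  rw [Ideal.height_eq_height_add_of_liesOver_of_hasGoingDown (p.under A) p]
  refine le_trans ?_ le_self_add
  rw [← RingEquiv.height_comap e.toRingEquiv (p.under A)]
  have : ((p.under A).comap e.toRingEquiv).IsPrime := Ideal.comap_isPrime _ _
  apply wih_height_vars
  intro i hi
  rw [Ideal.mem_comap, Ideal.mem_comap]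
  have h1 : algebraMap A (MvPolynomial σ K) (e.toRingEquiv (X i)) = g i := by
    have := hb.1.algebraMap_aevalEquiv (X i)
    rw [aeval_X] at this
    exact this
  rw [h1]
  exact hp i hi

theorem wih_integral_of_valuation {K S : Type*} [Field K] [CommRing S] [IsDomain S] [Algebra K S]
    (A : Subalgebra K S) (x : S)
    (h : ∀ V : ValuationSubring (FractionRing S),
      (∀ a ∈ A, algebraMap S (FractionRing S) a ∈ V) → algebraMap S (FractionRing S) x ∈ V) :
    IsIntegral A x := by
  let s : Set (FractionRing S) := (algebraMap S (FractionRing S)) '' (A : Set S)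
  have hx : algebraMap S (FractionRing S) x ∈
      (⨅ V : {V : ValuationSubring (FractionRing S) // s ⊆ V.toSubring}, V.1.toSubring) := by
    rw [Subring.mem_iInf]
    intro V
    exact h V.1 (fun a ha => V.2 ⟨a, ha, rfl⟩)
  rw [iInf_valuationSubring_superset] at hx
  have hx' : IsIntegral (Subring.closure s) (algebraMap S (FractionRing S) x) := hx
  have hcl : ∀ z ∈ Subring.closure s, ∃ a : A, algebraMap A (FractionRing S) a = z := by
    intro z hz
    have : Subring.closure s ≤ (algebraMap A (FractionRing S)).range := by
      rw [Subring.closure_le]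
      rintro _ ⟨a, ha, rfl⟩
      exact ⟨⟨a, ha⟩, rfl⟩
    exact this hz
  have h2 : IsIntegral A (algebraMap S (FractionRing S) x) := by
    have e : (algebraMap A (FractionRing S)).range = Subring.closure s := by
      apply le_antisymm
      · rintro _ ⟨a, rfl⟩
        exact Subring.subset_closure ⟨a.1, a.2, rfl⟩
      · intro z hz; exact hcl z hz
    obtain ⟨P, hP, hP0⟩ := hx'
    have hl : P ∈ Polynomial.lifts (((algebraMap A (FractionRing S)).rangeRestrict).comp (RingHom.id A) |> fun f => (Subring.inclusion e.le).comp f) := by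
      rw [Polynomial.lifts_iff_coeff_lifts]
      intro n
      obtain ⟨a, ha⟩ := hcl _ (P.coeff n).2
      exact ⟨a, Subtype.ext ha⟩
    obtain ⟨Q, hQ, -, hQm⟩ := Polynomial.lifts_and_natDegree_eq_and_monic hl hP
    refine ⟨Q, hQm, ?_⟩
    rw [← hQ, Polynomial.eval₂_map] at hP0
    exact hP0
  exact (isIntegral_algebraMap_iff (FaithfulSMul.algebraMap_injective S (FractionRing S))).mp h2

theorem wih_toeplitz {κ : Type*} [Field κ] (m s0 k : ℕ) (y : ℕ → κ)
    (W : Fin m → ℕ → κ)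
    (hW1 : ∀ a c, s0 + a.val ≤ c → c < s0 + k + a.val → W a c = y (c - a.val))
    (hW2 : ∀ a c, ¬ (s0 + a.val ≤ c ∧ c < s0 + k + a.val) → W a c = 0)
    (hdet : ∀ s, s0 ≤ s → s < s0 + k →
      Matrix.det (Matrix.of fun (a b : Fin m) => W a (s + b.val)) = 0) :
    ∀ s, s0 ≤ s → s < s0 + k → y s = 0 := by
  intro s
  induction s using Nat.strong_induction_on with
  | _ s ih =>
    intro h1 h2
    have hd := hdet s h1 h2
    rw [Matrix.det_of_isUpperTriangular] at hd
    · rw [Finset.prod_eq_zero_iff] at hd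
      obtain ⟨a, -, ha⟩ := hd
      rw [Matrix.of_apply, hW1 a _ (by omega) (by omega)] at ha
      simpa using ha
    · intro a b hab
      have hab' : b.val < a.val := hab
      rw [Matrix.of_apply]
      by_cases hc : s0 + a.val ≤ s + b.val ∧ s + b.val < s0 + k + a.val
      · rw [hW1 _ _ hc.1 hc.2]
        exact ih _ (by omega) (by omega) (by omega)
      · exact hW2 _ _ hc

theorem wih_val {L : Type*} [Field L] (V : ValuationSubring L) (m s0 k : ℕ) (hm : 0 < m)
    (y : ℕ → L) (Z : Fin m → ℕ → L)
    (hZ1 : ∀ a c, s0 + a.val ≤ c → c < s0 + k + a.val → Z a c - y (c - a.val) ∈ V)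
    (hZ2 : ∀ a c, ¬ (s0 + a.val ≤ c ∧ c < s0 + k + a.val) → Z a c ∈ V)
    (hdet : ∀ s, s0 ≤ s → s < s0 + k →
      Matrix.det (Matrix.of fun (a b : Fin m) => Z a (s + b.val)) ∈ V) :
    ∀ s, s0 ≤ s → s < s0 + k → y s ∈ V := by
  intro s1 h1 h2
  by_contra hns
  obtain ⟨M, hM, hmax⟩ := (Finset.Ico s0 (s0 + k)).exists_max_image (fun s => V.valuation (y s))
    ⟨s1, by simp [h1, h2]⟩
  rw [Finset.mem_Ico] at hM
  have hM1 : 1 < V.valuation (y M) := by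
    rw [← V.valuation_le_one_iff, not_le] at hns
    exact hns.trans_le (hmax s1 (by simp [h1, h2]))
  have hM0 : y M ≠ 0 := by
    rintro h0
    simp [h0] at hM1
  set u := (y M)⁻¹ with hu
  have hu1 : V.valuation u < 1 := by
    rw [hu, map_inv₀]
    exact inv_lt_one_of_one_lt₀ hM1
  have huV : u ∈ V := (V.valuation_le_one_iff u).mp hu1.le
  have huy : ∀ s, s0 ≤ s → s < s0 + k → u * y s ∈ V := by
    intro s hs1 hs2
    rw [← V.valuation_le_one_iff, map_mul]
    calc V.valuation u * V.valuation (y s) ≤ V.valuation u * V.valuation (y M) := by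
          gcongr; exact hmax s (by simp [hs1, hs2])
      _ = 1 := by rw [← map_mul, hu, inv_mul_cancel₀ hM0, map_one]
  have huZ : ∀ a c, u * Z a c ∈ V := by
    intro a c
    by_cases hc : s0 + a.val ≤ c ∧ c < s0 + k + a.val
    · have : u * Z a c = u * (Z a c - y (c - a.val)) + u * y (c - a.val) := by ring
      rw [this]
      exact V.add_mem _ _ (V.mul_mem _ _ huV (hZ1 a c hc.1 hc.2)) (huy _ (by omega) (by omega))
    · exact V.mul_mem _ _ huV (hZ2 a c hc)
  let r := IsLocalRing.residue V
  have hr0 : ∀ (z : V), r (⟨u, huV⟩ * z) = 0 := by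
    intro z
    have : r ⟨u, huV⟩ = 0 := by
      rw [IsLocalRing.residue_eq_zero_iff, ValuationSubring.valuation_lt_one_iff]
      exact hu1
    rw [map_mul, this, zero_mul]
  classical
  let yb : ℕ → IsLocalRing.ResidueField V := fun s =>
    if h : s0 ≤ s ∧ s < s0 + k then r ⟨u * y s, huy s h.1 h.2⟩ else 0
  let W : Fin m → ℕ → IsLocalRing.ResidueField V := fun a c => r ⟨u * Z a c, huZ a c⟩
  have hyM := wih_toeplitz m s0 k yb W ?_ ?_ ?_ M hM.1 hM.2
  · have : yb M = 1 := by
      simp only [yb, dif_pos hM]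
      rw [← map_one r]
      congr 1
      exact Subtype.ext (inv_mul_cancel₀ hM0)
    rw [this] at hyM
    exact one_ne_zero hyM
  · intro a c hc1 hc2
    have hc : s0 ≤ c - a.val ∧ c - a.val < s0 + k := by omega
    simp only [yb, W, dif_pos hc]
    rw [← sub_eq_zero, ← map_sub, ← hr0 ⟨_, hZ1 a c hc1 hc2⟩]
    congr 1
    apply Subtype.ext
    simp [mul_sub]
  · intro a c hc
    simp only [W]
    rw [← hr0 ⟨_, hZ2 a c hc⟩]
    rfl
  · intro s hs1 hs2
    have e1 : (Matrix.of fun (a b : Fin m) => W a (s + b.val)) =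
        r.mapMatrix (Matrix.of fun (a b : Fin m) => (⟨u * Z a (s + b.val), huZ _ _⟩ : V)) := by
      ext a b; rfl
    rw [e1, ← RingHom.map_det, ← hr0 (⟨u, huV⟩ ^ (m - 1) * ⟨_, hdet s hs1 hs2⟩)]
    congr 1
    apply Subtype.ext
    change V.subtype _ = _
    rw [RingHom.map_det]
    have e2 : V.subtype.mapMatrix
        (Matrix.of fun (a b : Fin m) => (⟨u * Z a (s + b.val), huZ _ _⟩ : V)) =
        u • (Matrix.of fun (a b : Fin m) => Z a (s + b.val)) := by
      ext a b; rfl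
    rw [e2, Matrix.det_smul, Fintype.card_fin]
    simp only [MulMemClass.coe_mul, SubmonoidClass.coe_pow]
    obtain ⟨m', rfl⟩ : ∃ m', m = m' + 1 := ⟨m - 1, by omega⟩
    simp only [Nat.add_sub_cancel]
    ring

/-- the generic matrix with columns indexed by natural numbers (zero beyond column `n`) -/
noncomputable def wihX (K : Type*) [Field K] (m n : ℕ) (a : Fin m) (c : ℕ) :
    MvPolynomial (Fin m × Fin n) K :=
  if h : c < n then MvPolynomial.X (a, ⟨c, h⟩) else 0

/-- the window minors -/
noncomputable def wihF (K : Type*) [Field K] (m n : ℕ) (s : ℕ) :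
    MvPolynomial (Fin m × Fin n) K :=
  Matrix.det (Matrix.of fun (a b : Fin m) => wihX K m n a (s + b.val))

/-- the parameter system: window minors, differences along diagonals, entries off the band -/
noncomputable def wihG (K : Type*) [Field K] (m n s0 k : ℕ) (ac : Fin m × Fin n) :
    MvPolynomial (Fin m × Fin n) K :=
  if s0 + ac.1.val ≤ ac.2.val ∧ ac.2.val < s0 + k + ac.1.val then
    if ac.1.val = 0 then wihF K m n ac.2.val
    else wihX K m n ac.1 ac.2.val - wihX K m n ⟨0, ac.1.pos⟩ (ac.2.val - ac.1.val)
  else wihX K m n ac.1 ac.2.val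

theorem wih_lower (K : Type*) [Field K] (m n s0 k : ℕ) (hm : 0 < m) (hk : s0 + k + m ≤ n + 1)
    (p : Ideal (MvPolynomial (Fin m × Fin n) K)) [p.IsPrime]
    (hp : ∀ s, s0 ≤ s → s < s0 + k → wihF K m n s ∈ p) : (k : ℕ∞) ≤ p.height := by
  classical
  let ι : Fin k → Fin m × Fin n := fun j => (⟨0, hm⟩, ⟨s0 + j.val, by omega⟩)
  have hι : Function.Injective ι := by
    intro j j' h
    have := congrArg (fun x => x.2.val) h
    simp only [ι] at this
    exact Fin.ext (by omega)
  have hT : (Finset.univ.image ι).card = k := by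
    rw [Finset.card_image_of_injective _ hι]; simp
  rw [← hT]
  apply wih_height_of_integral (wihG K m n s0 k)
  · rintro ⟨a0, c0⟩
    apply wih_integral_of_valuation
    intro V hV
    let φ := algebraMap (MvPolynomial (Fin m × Fin n) K)
      (FractionRing (MvPolynomial (Fin m × Fin n) K))
    have hG : ∀ ac, φ (wihG K m n s0 k ac) ∈ V := fun ac =>
      hV _ (Algebra.subset_adjoin ⟨ac, rfl⟩)
    have hZ1 : ∀ (a : Fin m) (c : ℕ), s0 + a.val ≤ c → c < s0 + k + a.val →
        φ (wihX K m n a c) - φ (wihX K m n ⟨0, hm⟩ (c - a.val)) ∈ V := by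
      intro a c h1 h2
      by_cases ha : a.val = 0
      · have : a = ⟨0, hm⟩ := Fin.ext ha
        subst this
        simp [V.zero_mem]
      · have := hG (a, ⟨c, by omega⟩)
        simp only [wihG] at this
        rw [if_pos ⟨h1, h2⟩, if_neg ha, map_sub] at this
        exact this
    have hZ2 : ∀ (a : Fin m) (c : ℕ), ¬ (s0 + a.val ≤ c ∧ c < s0 + k + a.val) →
        φ (wihX K m n a c) ∈ V := by
      intro a c h
      by_cases hc : c < n
      · have := hG (a, ⟨c, hc⟩)
        simp only [wihG] at this
        rwa [if_neg h] at this
      · simp [wihX, hc, V.zero_mem]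
    have hy := wih_val V m s0 k hm (fun s => φ (wihX K m n ⟨0, hm⟩ s))
      (fun a c => φ (wihX K m n a c)) hZ1 hZ2 (by
        intro s h1 h2
        have := hG (⟨0, hm⟩, ⟨s, by omega⟩)
        simp only [wihG] at this
        rw [if_pos (by omega), if_pos trivial, wihF, RingHom.map_det] at this
        exact this)
    have hfin : φ (wihX K m n a0 c0.val) ∈ V := by
      by_cases hc : s0 + a0.val ≤ c0.val ∧ c0.val < s0 + k + a0.val
      · have := V.add_mem _ _ (hZ1 a0 c0.val hc.1 hc.2) (hy (c0.val - a0.val) (by omega) (by omega))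
        simpa using this
      · exact hZ2 _ _ hc
    simpa [wihX] using hfin
  · intro ac hac
    simp only [Finset.mem_image, Finset.mem_univ, true_and] at hac
    obtain ⟨j, rfl⟩ := hac
    simp only [wihG, ι]
    rw [if_pos (by omega), if_pos trivial]
    exact hp _ (by omega) (by omega)

theorem wih_upper (K : Type*) [Field K] (m n s0 k : ℕ) (hm : 0 < m)
    (H : Ideal (MvPolynomial (Fin m × Fin n) K))
    (hH : H = Ideal.span (wihF K m n '' (Finset.Ico s0 (s0 + k) : Finset ℕ))) :
    ∃ p, H ≤ p ∧ p.IsPrime ∧ p.height ≤ k := by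
  classical
  rw [← Finset.coe_image] at hH
  have hne : H ≠ ⊤ := by
    have : H ≤ RingHom.ker (MvPolynomial.constantCoeff (σ := Fin m × Fin n) (R := K)) := by
      rw [hH, Ideal.span_le]
      intro x hx
      simp only [Finset.coe_image, Set.mem_image] at hx
      obtain ⟨s, -, rfl⟩ := hx
      rw [SetLike.mem_coe, RingHom.mem_ker, wihF, RingHom.map_det]
      apply Matrix.det_eq_zero_of_row_eq_zero ⟨0, hm⟩
      intro b
      simp only [RingHom.mapMatrix_apply, Matrix.map_apply, Matrix.of_apply, wihX]
      split_ifs <;> simp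
    exact ne_top_of_le_ne_top (RingHom.ker_ne_top _) this
  obtain ⟨p, hp⟩ := Ideal.nonempty_minimalPrimes hne
  refine ⟨p, hp.1.2, hp.1.1, ?_⟩
  rw [hH] at hp
  refine (Ideal.height_le_card_of_mem_minimalPrimes_span_finset hp).trans ?_
  have := Finset.card_image_le (s := Finset.Ico s0 (s0 + k)) (f := wihF K m n)
  rw [Nat.card_Ico] at this
  exact_mod_cast this.trans (by omega)


/-- The height of an ideal: the infimum of the heights (in the prime spectrum)
of the primes containing it. -/
noncomputable def idealHeight {R : Type*} [CommRing R] (I : Ideal R) : ℕ∞ :=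
  ⨅ p : { q : PrimeSpectrum R // I ≤ q.asIdeal }, Order.height p.val

/-- For `m - t + 1 ≤ i ≤ n - m + 1`, the ideal `H` generated by the `m - t + 1` maximal
minors `det X_{[j, j+m-1]}`, `i + t - m ≤ j ≤ i`, of the generic `m × n` matrix has
height `m - t + 1` (so it is a complete intersection). -/
theorem windows_ideal_height (K : Type*) [Field K] (m n : ℕ)
    (hm : 0 < m) (hmn : m < n) (t : ℕ) (ht1 : 1 ≤ t) (htm : t ≤ m)
    (i : ℕ) (hi1 : m - t + 1 ≤ i) (hi2 : i ≤ n - m + 1) :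
    idealHeight (Ideal.span { p : MvPolynomial (Fin m × Fin n) K |
        ∃ j : ℕ, ∃ _ : i + t - m ≤ j, ∃ _ : j ≤ i,
          p = Matrix.det (Matrix.of fun (a b : Fin m) =>
            MvPolynomial.X (a, (⟨j - 1 + b.val, by omega⟩ : Fin n))) })
      = (m - t + 1 : ℕ) := by
  have hset : { p : MvPolynomial (Fin m × Fin n) K |
        ∃ j : ℕ, ∃ _ : i + t - m ≤ j, ∃ _ : j ≤ i,
          p = Matrix.det (Matrix.of fun (a b : Fin m) =>
            MvPolynomial.X (a, (⟨j - 1 + b.val, by omega⟩ : Fin n))) } =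
      wihF K m n '' (Finset.Ico (i + t - m - 1) (i + t - m - 1 + (m - t + 1)) : Finset ℕ) := by
    have hF : ∀ s (hs : s + m ≤ n), wihF K m n s = Matrix.det (Matrix.of fun (a b : Fin m) =>
            MvPolynomial.X (a, (⟨s + b.val, by omega⟩ : Fin n))) := by
      intro s hs
      rw [wihF]
      congr 1
      ext1 a b
      have : s + b.val < n := by omega
      simp [wihX, this]
    ext p
    simp only [Set.mem_ofPred_eq, Set.mem_image, Finset.coe_Ico, Set.mem_Ico]
    constructor
    · rintro ⟨j, h1, h2, rfl⟩
      exact ⟨j - 1, by omega, hF _ (by omega)⟩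
    · rintro ⟨s, hs, rfl⟩
      exact ⟨s + 1, by omega, by omega, hF _ (by omega)⟩
  rw [hset]
  obtain ⟨p, hp1, hp2, hp3⟩ := wih_upper K m n (i + t - m - 1) (m - t + 1) hm _ rfl
  apply le_antisymm
  · refine (iInf_le _ ⟨⟨p, hp2⟩, hp1⟩).trans ?_
    rw [← PrimeSpectrum.height_eq_orderHeight]
    exact hp3
  · refine le_iInf ?_
    rintro ⟨⟨q, hq⟩, hHq⟩
    rw [← PrimeSpectrum.height_eq_orderHeight]
    apply wih_lower K m n (i + t - m - 1) (m - t + 1) hm (by omega) q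
    intro s h1 h2
    exact hHq (Ideal.subset_span ⟨s, by simp only [Finset.coe_Ico, Set.mem_Ico]; omega, rfl⟩)
end
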